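/- arXiv:1203.3578 — 5 statements merged into one kernel-verified Lean document; each statement's English description precedes it below -/
import Mathlib

section
/- Let V be a finite set, E a nonempty finite set of undirected edges on V (parallel edges allowed), and let f be an integer-valued skew supermodular biset function on V. Let Q(f,E) ⊆ ℝ^E be the polytope of all x with 0 ≤ x(e) ≤ 1 for every e ∈ E and x(δ_E(Ŝ)) ≥ f(Ŝ) for every biset Ŝ on V. Then every extreme point x of Q(f,E) has an edge e ∈ E with x(e) = 0 or x(e) ≥ 1/2. -/
noncomputable section

attribute [local instance] Classical.propDecidable

/-- A biset on `V`: an ordered pair of finsets `inner ⊆ outer`. -/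
structure Biset (V : Type*) where
  inner : Finset V
  outer : Finset V
  subset : inner ⊆ outer

namespace Biset

variable {V : Type*} [DecidableEq V]

instance [Fintype V] : Fintype (Biset V) :=
  Fintype.ofInjective (fun A => (A.inner, A.outer))
    (fun A B h => by
      cases A; cases B
      simp only [Prod.mk.injEq] at h
      cases h.1; cases h.2; rfl)

/-- The boundary `Γ(Ŝ) = S⁺ ∖ S`. -/
def boundary (A : Biset V) : Finset V := A.outer \ A.inner

def inter (A B : Biset V) : Biset V :=
  ⟨A.inner ∩ B.inner, A.outer ∩ B.outer, Finset.inter_subset_inter A.subset B.subset⟩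

def union (A B : Biset V) : Biset V :=
  ⟨A.inner ∪ B.inner, A.outer ∪ B.outer, Finset.union_subset_union A.subset B.subset⟩

def diff (A B : Biset V) : Biset V :=
  ⟨A.inner \ B.outer, A.outer \ B.inner, Finset.sdiff_subset_sdiff A.subset B.subset⟩

/-- Biset containment: `X̂ ⊆ Ŷ` iff `X ⊆ Y` and `X⁺ ⊆ Y⁺`. -/
def Sub (A B : Biset V) : Prop := A.inner ⊆ B.inner ∧ A.outer ⊆ B.outer

def Laminar (L : Finset (Biset V)) : Prop :=
  ∀ A ∈ L, ∀ B ∈ L, Sub A B ∨ Sub B A ∨ A.inner ∩ B.inner = ∅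

def StronglyLaminar (L : Finset (Biset V)) : Prop :=
  ∀ A ∈ L, ∀ B ∈ L, Sub A B ∨ Sub B A ∨
    (A.inner ∩ B.outer = ∅ ∧ B.inner ∩ A.outer = ∅)

def IntersectingSupermodular (f : Biset V → ℤ) : Prop :=
  ∀ A B : Biset V, (A.inner ∩ B.inner).Nonempty →
    f A + f B ≤ f (inter A B) + f (union A B)

def SkewSupermodular (f : Biset V → ℤ) : Prop :=
  ∀ A B : Biset V,
    f A + f B ≤ f (inter A B) + f (union A B) ∨
    f A + f B ≤ f (diff A B) + f (diff B A)

def vertexBiset (v : V) : Biset V := ⟨{v}, {v}, Finset.Subset.refl _⟩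

end Biset

/-- `γ = max { |Γ(Ŝ)| : f(Ŝ) > 0 }` (0 if no such biset exists). -/
def gammaOf {V : Type*} [Fintype V] [DecidableEq V] (f : Biset V → ℤ) : ℕ :=
  (Finset.univ.filter fun A : Biset V => 0 < f A).sup fun A => (Biset.boundary A).card

/-- The leaves (inclusion-minimal members) of a biset family. -/
def leaves {V : Type*} (L : Finset (Biset V)) : Finset (Biset V) :=
  L.filter fun A => ∀ B ∈ L, Biset.Sub B A → B = A

/-- `max_{Ŝ ∈ L} |Γ(Ŝ)|` (0 if `L` is empty). -/
def gammaL {V : Type*} [DecidableEq V] (L : Finset (Biset V)) : ℕ :=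
  L.sup fun A => (Biset.boundary A).card

section Undirected

variable {V E : Type*} [Fintype V] [DecidableEq V] [Fintype E]

/-- `δ_E(Ŝ)`: undirected edges covering the biset
(one end-node in the inner part, the other outside the outer part). -/
def uDelta (ep1 ep2 : E → V) (A : Biset V) : Finset E :=
  Finset.univ.filter fun e =>
    (ep1 e ∈ A.inner ∧ ep2 e ∉ A.outer) ∨ (ep2 e ∈ A.inner ∧ ep1 e ∉ A.outer)

/-- `δ_E(v) = δ_E(({v},{v}))`. -/
def uDeg (ep1 ep2 : E → V) (v : V) : Finset E :=
  uDelta ep1 ep2 (Biset.vertexBiset v)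

/-- The polytope `P(f,b,E)` for undirected edges. -/
def undirP (ep1 ep2 : E → V) (f : Biset V → ℤ) (B : Finset V) (b : V → ℕ) :
    Set (E → ℝ) :=
  {x | (∀ e : E, 0 ≤ x e ∧ x e ≤ 1) ∧
       (∀ A : Biset V, (f A : ℝ) ≤ ∑ e ∈ uDelta ep1 ep2 A, x e) ∧
       (∀ v ∈ B, ∑ e ∈ uDeg ep1 ep2 v, x e ≤ (b v : ℝ))}

/-- Incidence vector of an edge set. -/
def incVec (F : Finset E) : E → ℝ := fun e => if e ∈ F then 1 else 0

end Undirected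

/-- The polytope `Q(f,E)` (no degree constraints). -/
def undirQ {V E : Type*} [Fintype V] [DecidableEq V] [Fintype E]
    (ep1 ep2 : E → V) (f : Biset V → ℤ) : Set (E → ℝ) :=
  {x | (∀ e : E, 0 ≤ x e ∧ x e ≤ 1) ∧
       (∀ A : Biset V, (f A : ℝ) ≤ ∑ e ∈ uDelta ep1 ep2 A, x e)}

namespace Biset

variable {V : Type*}

instance : PartialOrder (Biset V) where
  le := Sub
  le_refl A := ⟨subset_rfl, subset_rfl⟩
  le_trans A B C h h' := ⟨h.1.trans h'.1, h.2.trans h'.2⟩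
  le_antisymm A B h h' := by
    cases A; cases B
    simp only [Biset.mk.injEq]
    exact ⟨h.1.antisymm h'.1, h.2.antisymm h'.2⟩

/-- The inclusion-maximal members of `L` strictly below `S`. -/
def children (L : Finset (Biset V)) (S : Biset V) : Finset (Biset V) :=
  L.filter fun C => C < S ∧ ∀ T ∈ L, C < T → ¬ T < S

/-- The inclusion-maximal members of `L`. -/
def roots (L : Finset (Biset V)) : Finset (Biset V) :=
  L.filter fun R => ∀ T ∈ L, ¬ R < T

theorem mem_children {L : Finset (Biset V)} {S C : Biset V} :
    C ∈ children L S ↔ C ∈ L ∧ C < S ∧ ∀ T ∈ L, C < T → ¬ T < S :=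
  Finset.mem_filter

theorem mem_roots {L : Finset (Biset V)} {R : Biset V} :
    R ∈ roots L ↔ R ∈ L ∧ ∀ T ∈ L, ¬ R < T :=
  Finset.mem_filter

theorem exists_le_mem_children {L : Finset (Biset V)} {A S : Biset V} (hA : A ∈ L) (h : A < S) :
    ∃ D ∈ children L S, A ≤ D := by
  obtain ⟨D, hAD, hD⟩ := (L.filter (· < S)).exists_le_maximal (Finset.mem_filter.2 ⟨hA, h⟩)
  have hD' := Finset.mem_filter.1 hD.prop
  exact ⟨D, Finset.mem_filter.2 ⟨hD'.1, hD'.2, fun T hT h1 h2 =>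
    h1.not_ge (hD.le_of_ge (Finset.mem_filter.2 ⟨hT, h2⟩) h1.le)⟩, hAD⟩

theorem exists_le_mem_roots {L : Finset (Biset V)} {A : Biset V} (hA : A ∈ L) :
    ∃ R ∈ roots L, A ≤ R := by
  obtain ⟨R, hAR, hR⟩ := L.exists_le_maximal hA
  exact ⟨R, Finset.mem_filter.2 ⟨hR.prop, fun T hT h => h.not_ge (hR.le_of_ge hT h.le)⟩, hAR⟩

theorem exists_mem_children {L : Finset (Biset V)} {A T : Biset V} (hA : A ∈ L) (hT : T ∈ L)
    (h : A < T) : ∃ S ∈ L, A ∈ children L S := by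
  obtain ⟨S, -, hS⟩ := (L.filter (A < ·)).exists_le_minimal (Finset.mem_filter.2 ⟨hT, h⟩)
  have hS' := Finset.mem_filter.1 hS.prop
  exact ⟨S, hS'.1, Finset.mem_filter.2 ⟨hA, hS'.2, fun T hT h1 h2 =>
    h2.not_ge (hS.le_of_le (Finset.mem_filter.2 ⟨hT, h1⟩) h2.le)⟩⟩

variable [DecidableEq V]

/-- Two bisets are uncrossed if they are nested or strongly disjoint. -/
def Uncrossed (A B : Biset V) : Prop :=
  Sub A B ∨ Sub B A ∨ (A.inner ∩ B.outer = ∅ ∧ B.inner ∩ A.outer = ∅)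

theorem Uncrossed.symm {A B : Biset V} (h : Uncrossed A B) : Uncrossed B A := by
  rcases h with h | h | h
  · exact Or.inr (Or.inl h)
  · exact Or.inl h
  · exact Or.inr (Or.inr ⟨h.2, h.1⟩)

theorem uncrossed_self (A : Biset V) : Uncrossed A A :=
  Or.inl ⟨subset_rfl, subset_rfl⟩

theorem uncrossed_inter_right (A B : Biset V) : Uncrossed (inter A B) B :=
  Or.inl ⟨Finset.inter_subset_right, Finset.inter_subset_right⟩

theorem uncrossed_union_right (A B : Biset V) : Uncrossed (union A B) B :=
  Or.inr (Or.inl ⟨Finset.subset_union_right, Finset.subset_union_right⟩)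

theorem uncrossed_diff_right (A B : Biset V) : Uncrossed (diff A B) B := by
  refine Or.inr (Or.inr ⟨?_, ?_⟩)
  · simp [diff]
  · simp [diff]

theorem uncrossed_diff_left (A B : Biset V) : Uncrossed (diff B A) B :=
  Or.inl ⟨Finset.sdiff_subset, Finset.sdiff_subset⟩

theorem Uncrossed.inter {A B C : Biset V} (hA : Uncrossed A C) (hB : Uncrossed B C) :
    Uncrossed (inter A B) C := by
  simp only [Uncrossed, Sub, Biset.inter, Finset.subset_iff, Finset.eq_empty_iff_forall_notMem,
    Finset.mem_inter] at *
  grind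

theorem Uncrossed.union {A B C : Biset V} (hAB : ¬ Uncrossed A B) (hA : Uncrossed A C)
    (hB : Uncrossed B C) : Uncrossed (union A B) C := by
  simp only [Uncrossed, Sub, Biset.union, Finset.subset_iff, Finset.eq_empty_iff_forall_notMem,
    Finset.mem_inter, Finset.mem_union] at *
  grind

theorem Uncrossed.diff {A B C : Biset V} (hAB : ¬ Uncrossed A B) (hA : Uncrossed A C)
    (hB : Uncrossed B C) : Uncrossed (diff A B) C := by
  simp only [Uncrossed, Sub, Biset.diff, Finset.subset_iff, Finset.eq_empty_iff_forall_notMem,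
    Finset.mem_inter, Finset.mem_sdiff] at *
  grind

/-- Distinct members of the family are strongly disjoint. -/
def StronglyDisjoint (F : Finset (Biset V)) : Prop :=
  ∀ A ∈ F, ∀ B ∈ F, ∀ v, v ∈ A.inner → v ∈ B.outer → A = B

theorem StronglyLaminar.le_or_le {L : Finset (Biset V)} (hL : StronglyLaminar L)
    {A B : Biset V} (hA : A ∈ L) (hB : B ∈ L) {v : V} (h : v ∈ A.inner) (h' : v ∈ B.outer) :
    A ≤ B ∨ B ≤ A := by
  rcases hL A hA B hB with h1 | h1 | h1
  · exact Or.inl h1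
  · exact Or.inr h1
  · exact absurd (Finset.mem_inter.2 ⟨h, h'⟩) (by simp [h1.1])

theorem StronglyLaminar.stronglyDisjoint_children {L : Finset (Biset V)} (hL : StronglyLaminar L)
    (S : Biset V) : StronglyDisjoint (children L S) := by
  intro A hA B hB v hv hv'
  simp only [children, Finset.mem_filter] at hA hB
  rcases hL.le_or_le hA.1 hB.1 hv hv' with h | h
  · exact h.eq_or_lt.resolve_right fun h => hA.2.2 B hB.1 h hB.2.1
  · exact (h.eq_or_lt.resolve_right fun h => hB.2.2 A hA.1 h hA.2.1).symm

theorem StronglyLaminar.stronglyDisjoint_roots {L : Finset (Biset V)} (hL : StronglyLaminar L) :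
    StronglyDisjoint (roots L) := by
  intro A hA B hB v hv hv'
  simp only [roots, Finset.mem_filter] at hA hB
  rcases hL.le_or_le hA.1 hB.1 hv hv' with h | h
  · exact h.eq_or_lt.resolve_right (hA.2 B hB.1)
  · exact (h.eq_or_lt.resolve_right (hB.2 A hA.1)).symm

/-- Every member of a strongly laminar family is either a root or the child of exactly one
member, so sums over the family split accordingly. -/
theorem StronglyLaminar.sum_roots_add_sum_children {L : Finset (Biset V)}
    (hL : StronglyLaminar L) (hne : ∀ A ∈ L, A.inner.Nonempty) (g : Biset V → ℝ) :
    ∑ R ∈ roots L, g R + ∑ S ∈ L, ∑ C ∈ children L S, g C = ∑ A ∈ L, g A := by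
  have hdisj : (L : Set (Biset V)).PairwiseDisjoint (children L) := by
    intro S hS T hT hST
    refine Finset.disjoint_left.2 fun C hCS hCT => hST ?_
    simp only [children, Finset.mem_filter] at hCS hCT
    obtain ⟨v, hv⟩ := hne C hCS.1
    have hvS := hCS.2.1.le.1 hv
    have hvT := T.subset (hCT.2.1.le.1 hv)
    rcases hL.le_or_le hS hT hvS hvT with h | h
    · exact h.eq_or_lt.resolve_right (hCT.2.2 S hS hCS.2.1)
    · exact (h.eq_or_lt.resolve_right (hCS.2.2 T hT hCT.2.1)).symm
  rw [← Finset.sum_biUnion hdisj,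
    ← Finset.sum_filter_add_sum_filter_not L (fun R => ∀ T ∈ L, ¬ R < T)]
  congr 1
  refine Finset.sum_congr ?_ fun _ _ => rfl
  ext C
  simp only [Finset.mem_biUnion, Finset.mem_filter]
  constructor
  · rintro ⟨S, hS, hC⟩
    have hC' := Finset.mem_filter.1 hC
    exact ⟨hC'.1, fun h => h S hS hC'.2.1⟩
  · rintro ⟨hC, h⟩
    push Not at h
    obtain ⟨T, hT, hCT⟩ := h
    exact exists_mem_children hC hT hCT

end Biset

section Covering

open Biset

variable {V E : Type*} [DecidableEq V] [Fintype E] {ep1 ep2 : E → V}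

theorem mem_uDelta {A : Biset V} {e : E} : e ∈ uDelta ep1 ep2 A ↔
    (ep1 e ∈ A.inner ∧ ep2 e ∉ A.outer) ∨ (ep2 e ∈ A.inner ∧ ep1 e ∉ A.outer) := by
  simp [uDelta]

theorem sum_mul_incVec (x : E → ℝ) (F : Finset E) : ∑ e, x e * incVec F e = ∑ e ∈ F, x e := by
  simp [incVec, Finset.sum_ite_mem]

theorem incVec_inter_add_union_le (A B : Biset V) (e : E) :
    incVec (uDelta ep1 ep2 (inter A B)) e + incVec (uDelta ep1 ep2 (Biset.union A B)) e ≤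
      incVec (uDelta ep1 ep2 A) e + incVec (uDelta ep1 ep2 B) e := by
  have a1 := @A.subset (ep1 e)
  have a2 := @A.subset (ep2 e)
  have b1 := @B.subset (ep1 e)
  have b2 := @B.subset (ep2 e)
  simp only [incVec, mem_uDelta, inter, Biset.union, Finset.mem_inter, Finset.mem_union]
  grind

theorem incVec_diff_add_diff_le (A B : Biset V) (e : E) :
    incVec (uDelta ep1 ep2 (diff A B)) e + incVec (uDelta ep1 ep2 (diff B A)) e ≤
      incVec (uDelta ep1 ep2 A) e + incVec (uDelta ep1 ep2 B) e := by
  have a1 := @A.subset (ep1 e)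
  have a2 := @A.subset (ep2 e)
  have b1 := @B.subset (ep1 e)
  have b2 := @B.subset (ep2 e)
  simp only [incVec, mem_uDelta, diff, Finset.mem_sdiff]
  grind

theorem tight_and_tight_of_incVec_le [Fintype V] {f : Biset V → ℤ} {x : E → ℝ}
    (hx : x ∈ undirQ ep1 ep2 f) (hpos : ∀ e, 0 < x e) {A B C D : Biset V}
    (hA : ∑ e ∈ uDelta ep1 ep2 A, x e = f A) (hB : ∑ e ∈ uDelta ep1 ep2 B, x e = f B)
    (hf : f A + f B ≤ f C + f D)
    (hle : ∀ e, incVec (uDelta ep1 ep2 C) e + incVec (uDelta ep1 ep2 D) e ≤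
      incVec (uDelta ep1 ep2 A) e + incVec (uDelta ep1 ep2 B) e) :
    ∑ e ∈ uDelta ep1 ep2 C, x e = f C ∧ ∑ e ∈ uDelta ep1 ep2 D, x e = f D ∧
      incVec (uDelta ep1 ep2 A) + incVec (uDelta ep1 ep2 B) =
        incVec (uDelta ep1 ep2 C) + incVec (uDelta ep1 ep2 D) := by
  have hC := hx.2 C
  have hD := hx.2 D
  have hf' : (f A : ℝ) + f B ≤ f C + f D := by exact_mod_cast hf
  have hterm : ∀ e ∈ Finset.univ, x e * (incVec (uDelta ep1 ep2 C) e +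
      incVec (uDelta ep1 ep2 D) e) ≤ x e * (incVec (uDelta ep1 ep2 A) e +
      incVec (uDelta ep1 ep2 B) e) :=
    fun e _ => mul_le_mul_of_nonneg_left (hle e) (hpos e).le
  have hsum := Finset.sum_le_sum hterm
  have hexp : ∀ S T : Biset V, ∑ e, x e * (incVec (uDelta ep1 ep2 S) e +
      incVec (uDelta ep1 ep2 T) e) =
      ∑ e ∈ uDelta ep1 ep2 S, x e + ∑ e ∈ uDelta ep1 ep2 T, x e := by
    intro S T
    simp only [mul_add, Finset.sum_add_distrib, sum_mul_incVec]
  have hsum' := hsum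
  rw [hexp, hexp] at hsum'
  refine ⟨by linarith, by linarith, ?_⟩
  have heq := (Finset.sum_eq_sum_iff_of_le hterm).1 (by rw [hexp, hexp]; linarith)
  funext e
  exact (mul_left_cancel₀ (hpos e).ne' (heq e (Finset.mem_univ e))).symm

/-- The span of the incidence vectors of the tight bisets at an extreme point strictly inside
the box is everything. -/
theorem span_tight_eq_top [Fintype V] {f : Biset V → ℤ} {x : E → ℝ}
    (hx : x ∈ Set.extremePoints ℝ (undirQ ep1 ep2 f)) (hpos : ∀ e, 0 < x e)
    (hlt : ∀ e, x e < 1) :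
    Submodule.span ℝ ((fun A => incVec (uDelta ep1 ep2 A)) ''
      {A : Biset V | ∑ e ∈ uDelta ep1 ep2 A, x e = f A}) = ⊤ := by
  by_contra hne
  obtain ⟨φ, hφ, hker⟩ := Submodule.exists_le_ker_of_lt_top _ (lt_top_iff_ne_top.2 hne)
  set y : E → ℝ := fun e => φ (Pi.single e 1) with hy
  have hφy : ∀ F : Finset E, φ (incVec F) = ∑ e ∈ F, y e := by
    intro F
    rw [← sum_mul_incVec]
    conv_lhs => rw [pi_eq_sum_univ' (incVec F), map_sum]
    refine Finset.sum_congr rfl fun e _ => ?_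
    rw [map_smul, smul_eq_mul, mul_comm, hy]
  have hev : ∀ᶠ t : ℝ in nhds 0, x + t • y ∈ undirQ ep1 ep2 f := by
    have h1 : ∀ e, ∀ᶠ t : ℝ in nhds 0, 0 ≤ x e + t * y e ∧ x e + t * y e ≤ 1 := by
      intro e
      have hc : Filter.Tendsto (fun t : ℝ => x e + t * y e) (nhds 0) (nhds (x e)) := by
        have : Continuous (fun t : ℝ => x e + t * y e) := by fun_prop
        simpa using this.tendsto 0
      exact (hc.eventually (lt_mem_nhds (hpos e))).mp
        ((hc.eventually (gt_mem_nhds (hlt e))).mono fun t h h' => ⟨h'.le, h.le⟩)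
    have h2 : ∀ A : Biset V, ∀ᶠ t : ℝ in nhds 0,
        (f A : ℝ) ≤ ∑ e ∈ uDelta ep1 ep2 A, (x e + t * y e) := by
      intro A
      rcases (hx.1.2 A).eq_or_lt with h | h
      · have hz : ∑ e ∈ uDelta ep1 ep2 A, y e = 0 := by
          rw [← hφy]
          exact hker (Submodule.subset_span ⟨A, h.symm, rfl⟩)
        refine Filter.Eventually.of_forall fun t => ?_
        rw [Finset.sum_add_distrib, ← Finset.mul_sum, hz, ← h]
        simp
      · have hc : Filter.Tendsto (fun t : ℝ => ∑ e ∈ uDelta ep1 ep2 A, (x e + t * y e)) (nhds 0)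
            (nhds (∑ e ∈ uDelta ep1 ep2 A, x e)) := by
          have : Continuous (fun t : ℝ => ∑ e ∈ uDelta ep1 ep2 A, (x e + t * y e)) := by fun_prop
          simpa using this.tendsto 0
        exact (hc.eventually (lt_mem_nhds h)).mono fun t ht => ht.le
    filter_upwards [Filter.eventually_all.2 h1, Filter.eventually_all.2 h2] with t ht1 ht2
    exact ⟨ht1, ht2⟩
  have hev' : ∀ᶠ t : ℝ in nhds 0, x + (-t) • y ∈ undirQ ep1 ep2 f := by
    have hc : Filter.Tendsto (fun t : ℝ => -t) (nhds 0) (nhds 0) := by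
      simpa using (continuous_neg (G := ℝ)).tendsto 0
    exact hc.eventually hev
  obtain ⟨t, ⟨ht1, ht2⟩, ht0⟩ := (((hev.and hev').filter_mono nhdsWithin_le_nhds).and
    (self_mem_nhdsWithin : Set.Ioi (0 : ℝ) ∈ nhdsWithin 0 (Set.Ioi 0))).exists
  have hseg : x ∈ openSegment ℝ (x + t • y) (x + (-t) • y) := by
    refine ⟨1 / 2, 1 / 2, by norm_num, by norm_num, by norm_num, ?_⟩
    module
  have hty : t • y = 0 := by simpa using hx.2 ht1 ht2 hseg
  have hy0 : y = 0 := (smul_eq_zero.1 hty).resolve_left (ne_of_gt ht0)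
  refine hφ (LinearMap.pi_ext' fun e => LinearMap.ext_ring ?_)
  exact congrFun hy0 e

/-- A tight biset whose incidence vector lies outside the span of a strongly laminar tight
family can be uncrossed against the whole family. -/
theorem exists_uncrossed_tight [Fintype V] {f : Biset V → ℤ} (hf : SkewSupermodular f) {x : E → ℝ}
    (hx : x ∈ undirQ ep1 ep2 f) (hpos : ∀ e, 0 < x e) {L : Finset (Biset V)}
    (hL : StronglyLaminar L) (htight : ∀ A ∈ L, ∑ e ∈ uDelta ep1 ep2 A, x e = f A)
    (p : Submodule ℝ (E → ℝ)) (hp : ∀ A ∈ L, incVec (uDelta ep1 ep2 A) ∈ p)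
    (A : Biset V) (hA : ∑ e ∈ uDelta ep1 ep2 A, x e = f A)
    (hAp : incVec (uDelta ep1 ep2 A) ∉ p) :
    ∃ A : Biset V, ∑ e ∈ uDelta ep1 ep2 A, x e = f A ∧ incVec (uDelta ep1 ep2 A) ∉ p ∧
      ∀ B ∈ L, Uncrossed A B := by
  induction hn : (L.filter fun B => ¬ Uncrossed A B).card using Nat.strong_induction_on
    generalizing A with
  | _ n ih =>
  by_cases hall : ∀ B ∈ L, Uncrossed A B
  · exact ⟨A, hA, hAp, hall⟩
  push Not at hall
  obtain ⟨B, hB, hAB⟩ := hall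
  have step : ∀ X : Biset V, ∑ e ∈ uDelta ep1 ep2 X, x e = f X →
      incVec (uDelta ep1 ep2 X) ∉ p → Uncrossed X B →
      (∀ C, Uncrossed A C → Uncrossed B C → Uncrossed X C) →
      ∃ A : Biset V, ∑ e ∈ uDelta ep1 ep2 A, x e = f A ∧ incVec (uDelta ep1 ep2 A) ∉ p ∧
        ∀ B ∈ L, Uncrossed A B := by
    intro X hX hXp hXB hXC
    refine ih _ ?_ X hX hXp rfl
    rw [← hn]
    refine Finset.card_lt_card ((Finset.ssubset_iff_of_subset ?_).2
      ⟨B, Finset.mem_filter.2 ⟨hB, hAB⟩, fun h => (Finset.mem_filter.1 h).2 hXB⟩)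
    intro C hC
    obtain ⟨hC, hC'⟩ := Finset.mem_filter.1 hC
    exact Finset.mem_filter.2 ⟨hC, fun h => hC' (hXC C h (hL B hB C hC))⟩
  have split : ∀ C D : Biset V, incVec (uDelta ep1 ep2 A) + incVec (uDelta ep1 ep2 B) =
      incVec (uDelta ep1 ep2 C) + incVec (uDelta ep1 ep2 D) →
      incVec (uDelta ep1 ep2 C) ∉ p ∨ incVec (uDelta ep1 ep2 D) ∉ p := by
    intro C D h
    by_contra! hcd
    exact hAp ((Submodule.add_mem_iff_left p (hp B hB)).1 (h ▸ p.add_mem hcd.1 hcd.2))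
  have hBA : ¬ Uncrossed B A := fun h => hAB h.symm
  rcases hf A B with h | h
  · obtain ⟨hC, hD, heq⟩ := tight_and_tight_of_incVec_le hx hpos hA (htight B hB) h
      (incVec_inter_add_union_le A B)
    rcases split _ _ heq with h | h
    · exact step _ hC h (uncrossed_inter_right A B) fun C h1 h2 => h1.inter h2
    · exact step _ hD h (uncrossed_union_right A B) fun C h1 h2 => Uncrossed.union hAB h1 h2
  · obtain ⟨hC, hD, heq⟩ := tight_and_tight_of_incVec_le hx hpos hA (htight B hB) h
      (incVec_diff_add_diff_le A B)
    rcases split _ _ heq with h | h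
    · exact step _ hC h (uncrossed_diff_right A B) fun C h1 h2 => Uncrossed.diff hAB h1 h2
    · exact step _ hD h (uncrossed_diff_left A B) fun C h1 h2 => Uncrossed.diff hBA h2 h1

theorem exists_stronglyLaminar_basis [Fintype V] {f : Biset V → ℤ} (hf : SkewSupermodular f) {x : E → ℝ}
    (hx : x ∈ Set.extremePoints ℝ (undirQ ep1 ep2 f)) (hpos : ∀ e, 0 < x e)
    (hlt : ∀ e, x e < 1) :
    ∃ L : Finset (Biset V), StronglyLaminar L ∧
      (∀ A ∈ L, ∑ e ∈ uDelta ep1 ep2 A, x e = f A) ∧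
      LinearIndepOn ℝ (fun A => incVec (uDelta ep1 ep2 A)) (L : Set (Biset V)) ∧
      Fintype.card E ≤ L.card := by
  set χ : Biset V → E → ℝ := fun A => incVec (uDelta ep1 ep2 A) with hχ
  let P : Finset (Biset V) → Prop := fun L => StronglyLaminar L ∧
    (∀ A ∈ L, ∑ e ∈ uDelta ep1 ep2 A, x e = f A) ∧ LinearIndepOn ℝ χ (L : Set (Biset V))
  have hP0 : P ∅ := ⟨by simp [StronglyLaminar], by simp, by simp⟩
  obtain ⟨L, -, hLmax⟩ := (Finset.univ.filter P).exists_le_maximal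
    (Finset.mem_filter.2 ⟨Finset.mem_univ _, hP0⟩)
  obtain ⟨hL, htight, hind⟩ : P L := (Finset.mem_filter.1 hLmax.prop).2
  refine ⟨L, hL, htight, hind, ?_⟩
  have hspan : Submodule.span ℝ (χ '' (L : Set (Biset V))) = ⊤ := by
    rw [eq_top_iff, ← span_tight_eq_top hx hpos hlt, Submodule.span_le]
    rintro _ ⟨A, hA, rfl⟩
    by_contra hAp
    obtain ⟨A, hA, hAp, hAL⟩ := exists_uncrossed_tight hf hx.1 hpos hL htight
      (Submodule.span ℝ (χ '' (L : Set (Biset V))))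
      (fun B hB => Submodule.subset_span ⟨B, hB, rfl⟩) A hA hAp
    have hP : P (insert A L) := by
      refine ⟨?_, ?_, ?_⟩
      · intro S hS T hT
        rcases Finset.mem_insert.1 hS with hSA | hS <;>
          rcases Finset.mem_insert.1 hT with hTA | hT
        · exact hSA ▸ hTA ▸ uncrossed_self A
        · exact hSA ▸ hAL T hT
        · exact hTA ▸ (hAL S hS).symm
        · exact hL S hS T hT
      · intro S hS
        rcases Finset.mem_insert.1 hS with rfl | hS
        · exact hA
        · exact htight S hS
      · rw [Finset.coe_insert]
        exact hind.insert hAp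
    have hmem := hLmax.le_of_ge (Finset.mem_filter.2 ⟨Finset.mem_univ _, hP⟩)
      (Finset.subset_insert A L) (Finset.mem_insert_self A L)
    exact hAp (Submodule.subset_span ⟨A, hmem, rfl⟩)
  have hcard := finrank_span_finset_le_card (R := ℝ) (L.image χ)
  rw [Set.finrank, Finset.coe_image, hspan, finrank_top, Module.finrank_fintype_fun_eq_card]
    at hcard
  exact hcard.trans Finset.card_image_le

theorem card_filter_mem_inner_le_one {F : Finset (Biset V)} (hF : StronglyDisjoint F) (v : V) :
    (F.filter fun A => v ∈ A.inner).card ≤ 1 := by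
  refine Finset.card_le_one.2 fun A hA B hB => ?_
  rw [Finset.mem_filter] at hA hB
  exact hF A hA.1 B hB.1 v hA.2 (B.subset hB.2)

theorem card_covered_le_two {F : Finset (Biset V)} (hF : StronglyDisjoint F) (e : E) :
    (F.filter fun A => e ∈ uDelta ep1 ep2 A).card ≤ 2 := by
  have hsub : (F.filter fun A => e ∈ uDelta ep1 ep2 A) ⊆
      (F.filter fun A => ep1 e ∈ A.inner) ∪ (F.filter fun A => ep2 e ∈ A.inner) := by
    intro A
    simp only [Finset.mem_filter, Finset.mem_union, mem_uDelta]
    tauto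
  have h1 := card_filter_mem_inner_le_one hF (ep1 e)
  have h2 := card_filter_mem_inner_le_one hF (ep2 e)
  have h3 := Finset.card_union_le (F.filter fun A => ep1 e ∈ A.inner)
    (F.filter fun A => ep2 e ∈ A.inner)
  have h4 := Finset.card_le_card hsub
  omega

theorem card_covered_le_one {F : Finset (Biset V)} (hF : StronglyDisjoint F) {S : Biset V}
    (hS : ∀ A ∈ F, A ≤ S) {e : E} (he : e ∈ uDelta ep1 ep2 S) :
    (F.filter fun A => e ∈ uDelta ep1 ep2 A).card ≤ 1 := by
  refine Finset.card_le_one.2 fun A hA B hB => ?_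
  rw [Finset.mem_filter, mem_uDelta] at hA hB
  rw [mem_uDelta] at he
  have a1 := @(hS A hA.1).2
  have b1 := @(hS B hB.1).2
  have key : ∀ v, v ∈ A.inner → v ∈ B.inner → A = B :=
    fun v h h' => hF A hA.1 B hB.1 v h (B.subset h')
  have ha := @A.subset
  have hb := @B.subset
  have hs := @S.subset
  grind

/-- The edges covering some child of `S` but not `S` itself. -/
def absorbed (ep1 ep2 : E → V) (L : Finset (Biset V)) (S : Biset V) : Finset E :=
  Finset.univ.filter fun e =>
    e ∉ uDelta ep1 ep2 S ∧ ∃ C ∈ children L S, e ∈ uDelta ep1 ep2 C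

theorem endpoints_mem_of_mem_absorbed {L : Finset (Biset V)} {S : Biset V} {e : E}
    (h : e ∈ absorbed ep1 ep2 L S) :
    ep1 e ∈ S.outer ∧ ep2 e ∈ S.outer ∧ (ep1 e ∈ S.inner ∨ ep2 e ∈ S.inner) := by
  obtain ⟨-, hS, C, hC, he⟩ := Finset.mem_filter.1 h
  have hle := (mem_children.1 hC).2.1.le
  have h1 := @hle.1
  have h2 := @S.subset
  rw [mem_uDelta] at hS he
  grind

theorem not_lt_of_mem_absorbed {L : Finset (Biset V)} (hL : StronglyLaminar L) {S T : Biset V}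
    {e : E} (hS : S ∈ L) (h : e ∈ absorbed ep1 ep2 L S) (h' : e ∈ absorbed ep1 ep2 L T) :
    ¬ S < T := by
  intro hlt
  obtain ⟨h1, h2, -⟩ := endpoints_mem_of_mem_absorbed h
  obtain ⟨D, hD, hSD⟩ := exists_le_mem_children hS hlt
  obtain ⟨-, -, C, hC, he⟩ := Finset.mem_filter.1 h'
  have hdisj := hL.stronglyDisjoint_children T C hC D hD
  rcases mem_uDelta.1 he with ⟨hi, ho⟩ | ⟨hi, ho⟩
  · exact ho (hdisj _ hi (hSD.2 h1) ▸ hSD.2 h2)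
  · exact ho (hdisj _ hi (hSD.2 h2) ▸ hSD.2 h1)

theorem card_absorbing_le_one {L : Finset (Biset V)} (hL : StronglyLaminar L) (e : E) :
    (L.filter fun S => e ∈ absorbed ep1 ep2 L S).card ≤ 1 := by
  refine Finset.card_le_one.2 fun S hS T hT => ?_
  rw [Finset.mem_filter] at hS hT
  obtain ⟨-, -, h⟩ := endpoints_mem_of_mem_absorbed hS.2
  obtain ⟨h1, h2, -⟩ := endpoints_mem_of_mem_absorbed hT.2
  have hcomp : S ≤ T ∨ T ≤ S := by
    rcases h with h | h
    · exact hL.le_or_le hS.1 hT.1 h h1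
    · exact hL.le_or_le hS.1 hT.1 h h2
  rcases hcomp with h | h
  · exact h.eq_or_lt.resolve_right (not_lt_of_mem_absorbed hL hS.1 hS.2 hT.2)
  · exact (h.eq_or_lt.resolve_right (not_lt_of_mem_absorbed hL hT.1 hT.2 hS.2)).symm

theorem not_mem_absorbed_of_covers_root {L : Finset (Biset V)} (hL : StronglyLaminar L)
    {R S : Biset V} {e : E} (hR : R ∈ roots L) (he : e ∈ uDelta ep1 ep2 R) (hS : S ∈ L) :
    e ∉ absorbed ep1 ep2 L S := by
  intro h
  obtain ⟨h1, h2, -⟩ := endpoints_mem_of_mem_absorbed h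
  obtain ⟨D, hD, hSD⟩ := exists_le_mem_roots hS
  have hdisj := hL.stronglyDisjoint_roots R hR D hD
  rcases mem_uDelta.1 he with ⟨hi, ho⟩ | ⟨hi, ho⟩
  · exact ho (hdisj _ hi (hSD.2 h1) ▸ hSD.2 h2)
  · exact ho (hdisj _ hi (hSD.2 h2) ▸ hSD.2 h1)

theorem sum_incVec_eq_card (F : Finset (Biset V)) (e : E) :
    ∑ A ∈ F, incVec (uDelta ep1 ep2 A) e =
      ((F.filter fun A => e ∈ uDelta ep1 ep2 A).card : ℝ) := by
  simp [incVec]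

/-- Each member of a strongly laminar family collects at least one token. -/
theorem one_le_token {f : Biset V → ℤ} {x : E → ℝ} (hpos : ∀ e, 0 < x e)
    (hhalf : ∀ e, x e < 1 / 2) {L : Finset (Biset V)} (hL : StronglyLaminar L)
    (htight : ∀ A ∈ L, ∑ e ∈ uDelta ep1 ep2 A, x e = f A)
    (hind : LinearIndepOn ℝ (fun A => incVec (uDelta ep1 ep2 A)) (L : Set (Biset V)))
    {S : Biset V} (hS : S ∈ L) :
    1 ≤ ∑ e ∈ uDelta ep1 ep2 S, x e - ∑ C ∈ children L S, ∑ e ∈ uDelta ep1 ep2 C, x e +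
      ((absorbed ep1 ep2 L S).card : ℝ) := by
  set w : E → ℝ := fun e => x e * (incVec (uDelta ep1 ep2 S) e -
    ∑ C ∈ children L S, incVec (uDelta ep1 ep2 C) e) + incVec (absorbed ep1 ep2 L S) e with hw
  have hsum : ∑ e ∈ uDelta ep1 ep2 S, x e - ∑ C ∈ children L S, ∑ e ∈ uDelta ep1 ep2 C, x e +
      ((absorbed ep1 ep2 L S).card : ℝ) = ∑ e, w e := by
    simp only [hw, Finset.sum_add_distrib, mul_sub, Finset.sum_sub_distrib, sum_mul_incVec,
      Finset.mul_sum]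
    rw [Finset.sum_comm]
    simp [incVec]
  have hedge : ∀ e, 0 ≤ w e ∧ (w e = 0 → incVec (uDelta ep1 ep2 S) e =
      ∑ C ∈ children L S, incVec (uDelta ep1 ep2 C) e) := by
    intro e
    have hx0 := hpos e
    have hx1 := hhalf e
    simp only [hw, sum_incVec_eq_card]
    have hdisj := hL.stronglyDisjoint_children S
    have h2 := card_covered_le_two (ep1 := ep1) (ep2 := ep2) hdisj e
    obtain ⟨k, hk⟩ : ∃ k, ((children L S).filter fun C => e ∈ uDelta ep1 ep2 C).card = k :=
      ⟨_, rfl⟩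
    rw [hk] at h2 ⊢
    by_cases heS : e ∈ uDelta ep1 ep2 S
    · have h1 := card_covered_le_one hdisj (fun A hA => (mem_children.1 hA).2.1.le) heS
      rw [hk] at h1
      have hab : e ∉ absorbed ep1 ep2 L S := fun h => (Finset.mem_filter.1 h).2.1 heS
      simp only [incVec, heS, hab, if_true, if_false]
      interval_cases k <;> norm_num
      exact ⟨(hpos e).le, (hpos e).ne'⟩
    · rcases Nat.eq_zero_or_pos k with rfl | hk0
      · have hab : e ∉ absorbed ep1 ep2 L S := by
          intro h
          obtain ⟨-, -, C, hC, he⟩ := Finset.mem_filter.1 h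
          exact Finset.filter_eq_empty_iff.1 (Finset.card_eq_zero.1 hk) hC he
        simp [incVec, heS, hab]
      · obtain ⟨C, hC⟩ := Finset.card_pos.1 (hk ▸ hk0)
        have hab : e ∈ absorbed ep1 ep2 L S :=
          Finset.mem_filter.2 ⟨Finset.mem_univ _, heS, C, (Finset.mem_filter.1 hC)⟩
        simp only [incVec, heS, hab, if_true, if_false]
        interval_cases k <;> norm_num <;> constructor <;> linarith
  have hpos' : 0 < ∑ e, w e := by
    refine lt_of_le_of_ne (Finset.sum_nonneg fun e _ => (hedge e).1) fun h0 => ?_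
    have hzero := (Finset.sum_eq_zero_iff_of_nonneg fun e _ => (hedge e).1).1 h0.symm
    have hchi : incVec (uDelta ep1 ep2 S) =
        ∑ C ∈ children L S, incVec (uDelta ep1 ep2 C) := by
      funext e
      rw [Finset.sum_apply]
      exact (hedge e).2 (hzero e (Finset.mem_univ e))
    have hSC : S ∉ (children L S : Set (Biset V)) := fun h => lt_irrefl S (mem_children.1 h).2.1
    have hsub : insert S (children L S : Set (Biset V)) ⊆ L :=
      Set.insert_subset hS fun C hC => (mem_children.1 hC).1
    refine ((linearIndepOn_insert hSC).1 (hind.mono hsub)).2 ?_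
    simp only [hchi]
    exact Submodule.sum_mem _ fun C hC => Submodule.subset_span ⟨C, hC, rfl⟩
  have hchildren : ∑ C ∈ children L S, ∑ e ∈ uDelta ep1 ep2 C, x e =
      ∑ C ∈ children L S, (f C : ℝ) :=
    Finset.sum_congr rfl fun C hC => htight C (mem_children.1 hC).1
  rw [← hsum, htight S hS, hchildren] at hpos'
  rw [htight S hS, hchildren]
  exact_mod_cast hpos'

/-- The tokens handed out by the edges total less than the number of edges. -/
theorem sum_token_lt {x : E → ℝ} (hpos : ∀ e, 0 < x e)
    (hhalf : ∀ e, x e < 1 / 2) {L : Finset (Biset V)} (hL : StronglyLaminar L)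
    (hne : ∀ A ∈ L, (uDelta ep1 ep2 A).Nonempty) (hLne : L.Nonempty) :
    ∑ S ∈ L, (∑ e ∈ uDelta ep1 ep2 S, x e - ∑ C ∈ children L S, ∑ e ∈ uDelta ep1 ep2 C, x e +
      ((absorbed ep1 ep2 L S).card : ℝ)) < Fintype.card E := by
  have hinner : ∀ A ∈ L, A.inner.Nonempty := by
    intro A hA
    obtain ⟨e, he⟩ := hne A hA
    rcases mem_uDelta.1 he with h | h
    · exact ⟨_, h.1⟩
    · exact ⟨_, h.1⟩
  have hroots := hL.sum_roots_add_sum_children hinner fun A => ∑ e ∈ uDelta ep1 ep2 A, x e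
  have hdisj := hL.stronglyDisjoint_roots
  have hsum : ∑ S ∈ L, (∑ e ∈ uDelta ep1 ep2 S, x e -
      ∑ C ∈ children L S, ∑ e ∈ uDelta ep1 ep2 C, x e + ((absorbed ep1 ep2 L S).card : ℝ)) =
      ∑ e, (x e * ((roots L).filter fun A => e ∈ uDelta ep1 ep2 A).card +
        (L.filter fun S => e ∈ absorbed ep1 ep2 L S).card) := by
    rw [Finset.sum_add_distrib, Finset.sum_sub_distrib, ← hroots, add_sub_cancel_right,
      Finset.sum_add_distrib]
    congr 1
    · simp only [← sum_incVec_eq_card, Finset.mul_sum]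
      rw [Finset.sum_comm]
      simp only [sum_mul_incVec]
    · simp only [Finset.card_filter, Nat.cast_sum]
      rw [Finset.sum_comm]
      simp
  have hstrict : ∀ e, ∀ R ∈ roots L, e ∈ uDelta ep1 ep2 R →
      x e * ((roots L).filter fun A => e ∈ uDelta ep1 ep2 A).card +
        ((L.filter fun S => e ∈ absorbed ep1 ep2 L S).card : ℝ) < 1 := by
    intro e R hR he
    have h0 : L.filter (fun S => e ∈ absorbed ep1 ep2 L S) = ∅ :=
      Finset.filter_eq_empty_iff.2 fun S hS => not_mem_absorbed_of_covers_root hL hR he hS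
    have h2 : (((roots L).filter fun A => e ∈ uDelta ep1 ep2 A).card : ℝ) ≤ 2 := by
      exact_mod_cast card_covered_le_two hdisj e
    rw [h0]
    have := hpos e
    have := hhalf e
    simp only [Finset.card_empty, Nat.cast_zero, add_zero]
    nlinarith
  obtain ⟨A, hA⟩ := hLne
  obtain ⟨R, hR, -⟩ := exists_le_mem_roots hA
  obtain ⟨e₀, he₀⟩ := hne R (mem_roots.1 hR).1
  have hone : (Fintype.card E : ℝ) = ∑ _e : E, (1 : ℝ) := by simp
  rw [hsum, hone]
  refine Finset.sum_lt_sum (fun e _ => ?_) ⟨e₀, Finset.mem_univ _, hstrict e₀ R hR he₀⟩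
  by_cases h : ∃ R ∈ roots L, e ∈ uDelta ep1 ep2 R
  · obtain ⟨R, hR, he⟩ := h
    exact (hstrict e R hR he).le
  · push Not at h
    rw [Finset.filter_eq_empty_iff.2 h]
    simpa using card_absorbing_le_one hL e

end Covering

theorem stmt_11 {V E : Type*} [Fintype V] [DecidableEq V] [Fintype E] [Nonempty E]
    (ep1 ep2 : E → V)
    (f : Biset V → ℤ) (hf : Biset.SkewSupermodular f)
    (x : E → ℝ) (hx : x ∈ Set.extremePoints ℝ (undirQ ep1 ep2 f)) :
    ∃ e : E, x e = 0 ∨ 1 / 2 ≤ x e := by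
  by_contra! hcon
  have hpos : ∀ e, 0 < x e := fun e => lt_of_le_of_ne (hx.1.1 e).1 (hcon e).1.symm
  have hhalf : ∀ e, x e < 1 / 2 := fun e => (hcon e).2
  obtain ⟨L, hL, htight, hind, hcard⟩ := exists_stronglyLaminar_basis hf hx hpos
    fun e => (hhalf e).trans (by norm_num)
  have hne : ∀ A ∈ L, (uDelta ep1 ep2 A).Nonempty := by
    intro A hA
    by_contra h
    refine hind.ne_zero hA ?_
    rw [Finset.not_nonempty_iff_eq_empty.1 h]
    funext e
    simp [incVec]
  have hLne : L.Nonempty := Finset.card_pos.1 (Fintype.card_pos.trans_le hcard)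
  have hlt := sum_token_lt hpos hhalf hL hne hLne
  have hge := Finset.sum_le_sum fun S hS => one_le_token hpos hhalf hL htight hind (S := S) hS
  rw [Finset.sum_const, nsmul_eq_mul, mul_one] at hge
  have : (Fintype.card E : ℝ) ≤ L.card := by exact_mod_cast hcard
  linarith
end
end

section
/- Let k be a positive integer and let G = (V, E ∪ F) be a simple k-connected undirected graph, where E and F are disjoint edge sets, such that |δ_E(v)| ≥ k−1 for all v ∈ V. Then there exists a set F' of undks edges on V with |F'| ≤ |F| such that the graph (V, E ∪ F') is k-connected and |δ_{F'}(v)| ≤ max{3, 3/2 + √(2k + 1/4)} for all v ∈ V. -/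
noncomputable section

attribute [local instance] Classical.propDecidable

variable {V : Type*} [Fintype V] [DecidableEq V]

/-- The simple graph on `V` with edge set `A`. -/
def graphOf (A : Finset (Sym2 V)) : SimpleGraph V :=
  SimpleGraph.fromEdgeSet (↑A)

/-- A graph (given by its edge set `A`) is `k`-connected: `|V| ≥ k+1` and deleting
any set of at most `k-1` vertices leaves a connected graph. -/
def KConnected (k : ℕ) (A : Finset (Sym2 V)) : Prop :=
  k + 1 ≤ Fintype.card V ∧
    ∀ X : Finset V, X.card ≤ k - 1 →
      ((graphOf A).induce ((↑X : Set V)ᶜ)).Connected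

/-- The set of edges of `F` incident to `v`. -/
def edegF (F : Finset (Sym2 V)) (v : V) : ℕ := (F.filter fun e => v ∈ e).card

/-- No edge of `D` joins a vertex of `A` to a vertex of `B`. -/
def NoEdgeBetween (D : Finset (Sym2 V)) (A B : Finset V) : Prop :=
  ∀ a ∈ A, ∀ b ∈ B, s(a, b) ∉ D

omit [Fintype V] [DecidableEq V] in
theorem NoEdgeBetween.symm {D : Finset (Sym2 V)} {A B : Finset V} (h : NoEdgeBetween D A B) :
    NoEdgeBetween D B A := fun a ha b hb => by
  rw [Sym2.eq_swap]; exact h b hb a ha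

theorem KConnected.card_add_card_le {k : ℕ} (hk : 1 ≤ k) {D : Finset (Sym2 V)}
    (hD : KConnected k D) {A B : Finset V} (hA : A.Nonempty) (hB : B.Nonempty)
    (hAB : Disjoint A B) (hno : NoEdgeBetween D A B) :
    A.card + B.card + k ≤ Fintype.card V := by
  by_contra hlt
  have hX : ((A ∪ B)ᶜ).card ≤ k - 1 := by
    rw [Finset.card_compl, Finset.card_union_of_disjoint hAB]; omega
  have hc := hD.2 _ hX
  obtain ⟨a, ha⟩ := hA
  obtain ⟨b, hb⟩ := hB
  have mem : ∀ x : V, x ∈ ((↑((A ∪ B)ᶜ) : Set V)ᶜ) ↔ x ∈ A ∨ x ∈ B := by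
    intro x; simp [or_iff_not_imp_left]
  obtain ⟨p⟩ := hc.preconnected ⟨a, (mem a).2 (Or.inl ha)⟩ ⟨b, (mem b).2 (Or.inr hb)⟩
  obtain ⟨d, -, h1, h2⟩ := p.exists_boundary_dart {x | x.1 ∈ A} ha
    (fun h => Finset.disjoint_left.1 hAB h hb)
  have h3 : d.snd.1 ∈ B := ((mem _).1 d.snd.2).resolve_left h2
  have h4 := d.adj
  simp only [SimpleGraph.comap_adj, graphOf, SimpleGraph.fromEdgeSet_adj] at h4
  exact hno _ h1 _ h3 (by simpa using h4.1)

theorem kConnected_of_forall_card_add_card_le {k : ℕ} (hk : 1 ≤ k) {D : Finset (Sym2 V)}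
    (hn : k + 1 ≤ Fintype.card V)
    (h : ∀ A B : Finset V, A.Nonempty → B.Nonempty → Disjoint A B → NoEdgeBetween D A B →
      A.card + B.card + k ≤ Fintype.card V) : KConnected k D := by
  refine ⟨hn, fun X hX => ?_⟩
  have hne : ∃ x, x ∉ X := by
    by_contra! hall
    have : X = Finset.univ := Finset.eq_univ_iff_forall.2 hall
    rw [this, Finset.card_univ] at hX
    omega
  obtain ⟨x₀, hx₀⟩ := hne
  set H := (graphOf D).induce ((↑X : Set V)ᶜ) with hH
  have : Nonempty ((↑X : Set V)ᶜ : Set V) := ⟨⟨x₀, by simpa using hx₀⟩⟩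
  refine SimpleGraph.Connected.mk ?_
  by_contra hcon
  simp only [SimpleGraph.Preconnected, not_forall] at hcon
  obtain ⟨x, y, hxy⟩ := hcon
  let A : Finset V := Finset.univ.filter fun z => ∃ hz : z ∈ ((↑X : Set V)ᶜ), H.Reachable x ⟨z, hz⟩
  let B : Finset V := Xᶜ \ A
  have hAX : A ⊆ Xᶜ := by
    intro z hz
    obtain ⟨hz, -⟩ := (Finset.mem_filter.1 hz).2
    simpa using hz
  have hcard := h A B
    ⟨x.1, Finset.mem_filter.2 ⟨Finset.mem_univ _, x.2, SimpleGraph.Reachable.refl _⟩⟩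
    ⟨y.1, Finset.mem_sdiff.2 ⟨Finset.mem_compl.2 y.2, fun hy => by
      obtain ⟨_, hy⟩ := (Finset.mem_filter.1 hy).2
      exact hxy hy⟩⟩ Finset.disjoint_sdiff (by
      intro a ha b hb hab
      obtain ⟨haX, har⟩ := (Finset.mem_filter.1 ha).2
      obtain ⟨hbX, hbA⟩ := Finset.mem_sdiff.1 hb
      have hbX' : b ∈ ((↑X : Set V)ᶜ) := by simpa using hbX
      refine hbA (Finset.mem_filter.2 ⟨Finset.mem_univ _, hbX', har.trans ?_⟩)
      refine SimpleGraph.Adj.reachable ?_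
      simp only [hH, SimpleGraph.comap_adj, graphOf, SimpleGraph.fromEdgeSet_adj]
      refine ⟨by simpa using hab, ?_⟩
      rintro rfl
      exact hbA ha)
  have h1 : A.card + B.card = Xᶜ.card := by
    rw [add_comm]; exact Finset.card_sdiff_add_card_eq_card hAX
  rw [Finset.card_compl] at h1
  omega

/-- A pair of disjoint sets `A ∋ v` and `B ∋ u` whose only connection in `D` is the edge `uv`,
and which leaves out exactly `k - 1` vertices. -/
structure TightPair (k : ℕ) (D : Finset (Sym2 V)) (v u : V) (A B : Finset V) : Prop where
  left_mem : v ∈ A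
  right_mem : u ∈ B
  disj : Disjoint A B
  noEdge : NoEdgeBetween (D.erase s(v, u)) A B
  card : A.card + B.card + k = Fintype.card V + 1

theorem TightPair.symm {k : ℕ} {D : Finset (Sym2 V)} {v u : V} {A B : Finset V}
    (h : TightPair k D v u A B) : TightPair k D u v B A where
  left_mem := h.right_mem
  right_mem := h.left_mem
  disj := h.disj.symm
  noEdge := by rw [Sym2.eq_swap]; exact h.noEdge.symm
  card := by have := h.card; omega

theorem KConnected.card_add_card_le_succ {k : ℕ} (hk : 1 ≤ k) {D : Finset (Sym2 V)}
    (hD : KConnected k D) {v u : V} {A B : Finset V} (hv : v ∈ A) (hu : u ∈ B)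
    (hAB : Disjoint A B) (hno : NoEdgeBetween (D.erase s(v, u)) A B) :
    A.card + B.card + k ≤ Fintype.card V + 1 := by
  have hvB : v ∉ B := Finset.disjoint_left.1 hAB hv
  have huA : u ∉ A := fun h => Finset.disjoint_left.1 hAB h hu
  by_cases hA : (A.erase v).Nonempty
  · have := hD.card_add_card_le hk hA ⟨u, hu⟩ (hAB.mono_left (Finset.erase_subset _ _)) (by
      intro a ha b hb hab
      obtain ⟨hav, ha⟩ := Finset.mem_erase.1 ha
      refine hno a ha b hb (Finset.mem_erase.2 ⟨fun h => ?_, hab⟩)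
      rcases Sym2.eq_iff.1 h with h | h
      · exact hav h.1
      · exact huA (h.1 ▸ ha))
    rw [Finset.card_erase_of_mem hv] at this
    omega
  by_cases hB : (B.erase u).Nonempty
  · have := hD.card_add_card_le hk ⟨v, hv⟩ hB (hAB.mono_right (Finset.erase_subset _ _)) (by
      intro a ha b hb hab
      obtain ⟨hbu, hb⟩ := Finset.mem_erase.1 hb
      refine hno a ha b hb (Finset.mem_erase.2 ⟨fun h => ?_, hab⟩)
      rcases Sym2.eq_iff.1 h with h | h
      · exact hbu h.2
      · exact hvB (h.2 ▸ hb))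
    rw [Finset.card_erase_of_mem hu] at this
    omega
  · have h1 : (A.erase v).card = 0 := by
      rw [Finset.card_eq_zero]; exact Finset.not_nonempty_iff_eq_empty.1 hA
    have h2 : (B.erase u).card = 0 := by
      rw [Finset.card_eq_zero]; exact Finset.not_nonempty_iff_eq_empty.1 hB
    rw [Finset.card_erase_of_mem hv] at h1
    rw [Finset.card_erase_of_mem hu] at h2
    have := hD.1
    omega

/-- A pair separated in `D - uv` by fewer than `k` vertices has `uv` running across it. -/
theorem KConnected.mem_or_mem_of_erase {k : ℕ} (hk : 1 ≤ k) {D : Finset (Sym2 V)}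
    (hD : KConnected k D) {v u : V} {A B : Finset V} (hA : A.Nonempty) (hB : B.Nonempty)
    (hAB : Disjoint A B) (hno : NoEdgeBetween (D.erase s(v, u)) A B)
    (hlt : Fintype.card V < A.card + B.card + k) :
    (v ∈ A ∧ u ∈ B) ∨ (u ∈ A ∧ v ∈ B) := by
  by_contra hcon
  have := hD.card_add_card_le hk hA hB hAB (by
    intro a ha b hb hab
    refine hno a ha b hb (Finset.mem_erase.2 ⟨fun h => hcon ?_, hab⟩)
    rcases Sym2.eq_iff.1 h with ⟨rfl, rfl⟩ | ⟨rfl, rfl⟩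
    · exact Or.inl ⟨ha, hb⟩
    · exact Or.inr ⟨ha, hb⟩)
  omega

/-- The two sides of a critical edge. -/
theorem KConnected.exists_tightPair {k : ℕ} (hk : 1 ≤ k) {D : Finset (Sym2 V)}
    (hD : KConnected k D) {v u : V} (hcrit : ¬ KConnected k (D.erase s(v, u))) :
    ∃ A B, TightPair k D v u A B := by
  have hcon : ¬ ∀ A B : Finset V, A.Nonempty → B.Nonempty → Disjoint A B →
      NoEdgeBetween (D.erase s(v, u)) A B → A.card + B.card + k ≤ Fintype.card V :=
    fun h => hcrit (kConnected_of_forall_card_add_card_le hk hD.1 h)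
  push Not at hcon
  obtain ⟨A, B, hA, hB, hAB, hno, hlt⟩ := hcon
  rcases hD.mem_or_mem_of_erase hk hA hB hAB hno hlt with ⟨hv, hu⟩ | ⟨hu, hv⟩
  · have := hD.card_add_card_le_succ hk hv hu hAB hno
    exact ⟨A, B, hv, hu, hAB, hno, by omega⟩
  · have := hD.card_add_card_le_succ hk hv hu hAB.symm hno.symm
    exact ⟨B, A, hv, hu, hAB.symm, hno.symm, by omega⟩

theorem edegF_add_card_lt {D : Finset (Sym2 V)} (hD : ∀ e ∈ D, ¬ e.IsDiag) {u : V}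
    {Z : Finset V} (hu : u ∉ Z) (hZ : ∀ z ∈ Z, s(u, z) ∉ D) :
    edegF D u + Z.card + 1 ≤ Fintype.card V := by
  have hsub : (D.filter fun e => u ∈ e) ⊆ (insert u Z)ᶜ.image fun y => s(u, y) := by
    intro e he
    obtain ⟨heD, hue⟩ := Finset.mem_filter.1 he
    obtain ⟨y, rfl⟩ := Sym2.mem_iff_exists.1 hue
    refine Finset.mem_image.2 ⟨y, ?_, rfl⟩
    rw [Finset.mem_compl, Finset.mem_insert, not_or]
    refine ⟨?_, fun hy => hZ y hy heD⟩
    rintro rfl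
    exact hD _ heD (Sym2.mk_isDiag_iff.2 rfl)
  have h1 : edegF D u ≤ (insert u Z)ᶜ.card := (Finset.card_le_card hsub).trans Finset.card_image_le
  have h2 := Finset.card_compl_add_card (insert u Z)
  rw [Finset.card_insert_of_notMem hu] at h2
  omega

/-- Uncrossing two tight pairs at a common end `u` of degree greater than `k`. -/
theorem TightPair.card_lt_card {k : ℕ} (hk : 1 ≤ k) {D : Finset (Sym2 V)}
    (hD : KConnected k D) (hdiag : ∀ e ∈ D, ¬ e.IsDiag) {u v w : V} (hvw : v ≠ w)
    (hv : s(u, v) ∈ D) (hw : s(u, w) ∈ D) (hdeg : k + 1 ≤ edegF D u)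
    {A₁ B₁ A₂ B₂ : Finset V} (h₁ : TightPair k D u v A₁ B₁) (h₂ : TightPair k D u w A₂ B₂) :
    B₂.card < A₁.card := by
  have huA : u ∈ A₁ ∩ A₂ := Finset.mem_inter.2 ⟨h₁.left_mem, h₂.left_mem⟩
  have hvB₂ : v ∉ B₂ := fun h => h₂.noEdge u h₂.left_mem v h
    (Finset.mem_erase.2 ⟨fun h => hvw (Sym2.congr_right.1 h), hv⟩)
  have hwB₁ : w ∉ B₁ := fun h => h₁.noEdge u h₁.left_mem w h
    (Finset.mem_erase.2 ⟨fun h => hvw (Sym2.congr_right.1 h).symm, hw⟩)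
  have huB₁ : u ∉ B₁ := Finset.disjoint_left.1 h₁.disj h₁.left_mem
  have huB₂ : u ∉ B₂ := Finset.disjoint_left.1 h₂.disj h₂.left_mem
  have key₁ : ∀ a ∈ A₁, ∀ b ∈ B₁, s(a, b) ∈ D → a = u ∧ b = v := by
    intro a ha b hb hab
    by_contra hne
    refine h₁.noEdge a ha b hb (Finset.mem_erase.2 ⟨fun h => ?_, hab⟩)
    rcases Sym2.eq_iff.1 h with h | h
    · exact hne h
    · exact huB₁ (h.2 ▸ hb)
  have key₂ : ∀ a ∈ A₂, ∀ b ∈ B₂, s(a, b) ∈ D → a = u ∧ b = w := by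
    intro a ha b hb hab
    by_contra hne
    refine h₂.noEdge a ha b hb (Finset.mem_erase.2 ⟨fun h => ?_, hab⟩)
    rcases Sym2.eq_iff.1 h with h | h
    · exact hne h
    · exact huB₂ (h.2 ▸ hb)
  have hdisj : Disjoint (A₁ ∩ A₂) (B₁ ∪ B₂) := by
    rw [Finset.disjoint_union_right]
    exact ⟨h₁.disj.mono_left Finset.inter_subset_left, h₂.disj.mono_left Finset.inter_subset_right⟩
  have hdisj' : Disjoint (A₁ ∪ A₂) (B₁ ∩ B₂) := by
    rw [Finset.disjoint_union_left]
    exact ⟨h₁.disj.mono_right Finset.inter_subset_left, h₂.disj.mono_right Finset.inter_subset_right⟩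
  have hcA := Finset.card_union_add_card_inter A₁ A₂
  have hcB := Finset.card_union_add_card_inter B₁ B₂
  have hc₁ := h₁.card
  have hc₂ := h₂.card
  have hcorner : (A₁ ∩ A₂).card + (B₁ ∪ B₂).card + k ≤ Fintype.card V + 1 := by
    by_cases hne : ((A₁ ∩ A₂).erase u).Nonempty
    · have := hD.card_add_card_le hk hne ⟨v, Finset.mem_union_left _ h₁.right_mem⟩
        (hdisj.mono_left (Finset.erase_subset _ _)) (by
        intro a ha b hb hab
        obtain ⟨hau, ha⟩ := Finset.mem_erase.1 ha
        obtain ⟨ha₁, ha₂⟩ := Finset.mem_inter.1 ha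
        rcases Finset.mem_union.1 hb with hb | hb
        · exact hau (key₁ a ha₁ b hb hab).1
        · exact hau (key₂ a ha₂ b hb hab).1)
      rw [Finset.card_erase_of_mem huA] at this
      omega
    · have h1 : ((A₁ ∩ A₂).erase u).card = 0 := by
        rw [Finset.card_eq_zero]; exact Finset.not_nonempty_iff_eq_empty.1 hne
      rw [Finset.card_erase_of_mem huA] at h1
      have h2 := edegF_add_card_lt hdiag (u := u) (Z := ((B₁ ∪ B₂).erase v).erase w) (by
        simp [huB₁, huB₂]) (by
        intro z hz hzD
        simp only [Finset.mem_erase, Finset.mem_union] at hz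
        obtain ⟨hzw, hzv, hz | hz⟩ := hz
        · exact hzv (key₁ u h₁.left_mem z hz hzD).2
        · exact hzw (key₂ u h₂.left_mem z hz hzD).2)
      rw [Finset.card_erase_of_mem (Finset.mem_erase.2
        ⟨hvw.symm, Finset.mem_union_right _ h₂.right_mem⟩),
        Finset.card_erase_of_mem (Finset.mem_union_left _ h₁.right_mem)] at h2
      omega
  have hempty : (B₁ ∩ B₂).card = 0 := by
    by_contra hne
    have hne' : (B₁ ∩ B₂).Nonempty := Finset.card_ne_zero.1 hne
    have := hD.card_add_card_le hk ⟨u, Finset.mem_union_left A₂ h₁.left_mem⟩ hne' hdisj' (by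
      intro a ha b hb hab
      obtain ⟨hb₁, hb₂⟩ := Finset.mem_inter.1 hb
      rcases Finset.mem_union.1 ha with ha | ha
      · exact hvB₂ ((key₁ a ha b hb₁ hab).2 ▸ hb₂)
      · exact hwB₁ ((key₂ a ha b hb₂ hab).2 ▸ hb₁))
    omega
  have : 0 < (A₁ ∩ A₂).card := Finset.card_pos.2 ⟨u, huA⟩
  omega

/-- Moving the end `v` of a critical edge `uv` inside a smallest tight set. -/
theorem KConnected.exchange {k : ℕ} (hk : 1 ≤ k) {D : Finset (Sym2 V)}
    (hD : KConnected k D) {v u x : V} {A B : Finset V} (hAB : TightPair k D v u A B)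
    (hmin : ∀ A' B', TightPair k D v u A' B' → A.card ≤ A'.card) (hx : x ∈ A) :
    KConnected k (insert s(x, u) (D.erase s(v, u))) := by
  refine kConnected_of_forall_card_add_card_le hk hD.1 fun A' B' hA' hB' hdisj hno => ?_
  by_contra! hlt
  have hno' : NoEdgeBetween (D.erase s(v, u)) A' B' := fun a ha b hb hab =>
    hno a ha b hb (Finset.mem_insert_of_mem hab)
  wlog hvu : v ∈ A' ∧ u ∈ B' generalizing A' B'
  · have hvu' := (hD.mem_or_mem_of_erase hk hA' hB' hdisj hno' hlt).resolve_left hvu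
    exact this B' A' hB' hA' hdisj.symm hno.symm (by omega) hno'.symm ⟨hvu'.2, hvu'.1⟩
  obtain ⟨hv, hu⟩ := hvu
  have hxA' : x ∉ A' := fun h => hno x h u hu (Finset.mem_insert_self _ _)
  have hd₁ : Disjoint (A ∩ A') (B ∪ B') := by
    rw [Finset.disjoint_union_right]
    exact ⟨hAB.disj.mono_left Finset.inter_subset_left, hdisj.mono_left Finset.inter_subset_right⟩
  have hd₂ : Disjoint (A ∪ A') (B ∩ B') := by
    rw [Finset.disjoint_union_left]
    exact ⟨hAB.disj.mono_right Finset.inter_subset_left, hdisj.mono_right Finset.inter_subset_right⟩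
  have hn₁ : NoEdgeBetween (D.erase s(v, u)) (A ∩ A') (B ∪ B') := by
    intro a ha b hb
    obtain ⟨ha, ha'⟩ := Finset.mem_inter.1 ha
    rcases Finset.mem_union.1 hb with hb | hb
    · exact hAB.noEdge a ha b hb
    · exact hno' a ha' b hb
  have hn₂ : NoEdgeBetween (D.erase s(v, u)) (A ∪ A') (B ∩ B') := by
    intro a ha b hb
    obtain ⟨hb, hb'⟩ := Finset.mem_inter.1 hb
    rcases Finset.mem_union.1 ha with ha | ha
    · exact hAB.noEdge a ha b hb
    · exact hno' a ha b hb'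
  have hvm : v ∈ A ∩ A' := Finset.mem_inter.2 ⟨hAB.left_mem, hv⟩
  have hum : u ∈ B ∪ B' := Finset.mem_union_right _ hu
  have h₁ := hD.card_add_card_le_succ hk hvm hum hd₁ hn₁
  have h₂ := hD.card_add_card_le_succ hk (Finset.mem_union_right A hv)
    (Finset.mem_inter.2 ⟨hAB.right_mem, hu⟩) hd₂ hn₂
  have hcA := Finset.card_union_add_card_inter A A'
  have hcB := Finset.card_union_add_card_inter B B'
  have hc := hAB.card
  have hle := hmin (A ∩ A') (B ∪ B') ⟨hvm, hum, hd₁, hn₁, by omega⟩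
  have hlt' : (A ∩ A').card < A.card := Finset.card_lt_card
    ⟨Finset.inter_subset_left, fun h => hxA' (Finset.mem_inter.1 (h hx)).2⟩
  omega

/-- In a set `F` of critical edges each vertex of which has degree greater than `k` as soon as it
meets two of them, one can choose distinct ends for distinct edges. -/
theorem KConnected.exists_injOn_end {k : ℕ} (hk : 1 ≤ k) {D F : Finset (Sym2 V)}
    (hD : KConnected k D) (hdiag : ∀ e ∈ D, ¬ e.IsDiag) (hF : F ⊆ D)
    (hcrit : ∀ e ∈ F, ¬ KConnected k (D.erase e))
    (hdeg : ∀ v, 2 ≤ edegF F v → k + 1 ≤ edegF D v) :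
    ∃ h : Sym2 V → V, (∀ e ∈ F, h e ∈ e) ∧ Set.InjOn h (F : Set (Sym2 V)) := by
  have hex : ∀ e : Sym2 V, ∃ u : V, e ∈ F → ∃ w A B, e = s(u, w) ∧ TightPair k D u w A B ∧
      A.card ≤ B.card := by
    intro e
    induction e with | _ a b
    by_cases he : s(a, b) ∈ F
    · obtain ⟨A, B, hAB⟩ := hD.exists_tightPair hk (hcrit _ he)
      rcases le_total A.card B.card with hle | hle
      · exact ⟨a, fun _ => ⟨b, A, B, rfl, hAB, hle⟩⟩
      · exact ⟨b, fun _ => ⟨a, B, A, Sym2.eq_swap, hAB.symm, hle⟩⟩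
    · exact ⟨a, fun h => absurd h he⟩
  choose h hh using hex
  refine ⟨h, fun e he => ?_, fun e he f hf hef => ?_⟩
  · obtain ⟨w, _, _, hw, -⟩ := hh e he
    exact hw.symm.subst (motive := fun f => h e ∈ f) (Sym2.mem_mk_left _ _)
  · by_contra hne
    obtain ⟨v, A₁, B₁, hv, h₁, hle₁⟩ := hh e he
    obtain ⟨w, A₂, B₂, hw, h₂, hle₂⟩ := hh f hf
    rw [← hef] at hw h₂
    generalize h e = u at *
    have hvw : v ≠ w := by
      rintro rfl
      exact hne (hv.trans hw.symm)
    have hdu : k + 1 ≤ edegF D u := by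
      refine hdeg u ?_
      rw [← Finset.card_pair hne]
      refine Finset.card_le_card fun g hg => ?_
      rcases Finset.mem_insert.1 hg with rfl | hg
      · exact Finset.mem_filter.2 ⟨he, by rw [hv]; exact Sym2.mem_mk_left _ _⟩
      · rw [Finset.mem_singleton] at hg
        subst hg
        exact Finset.mem_filter.2 ⟨hf, by rw [hw]; exact Sym2.mem_mk_left _ _⟩
    have hv' : s(u, v) ∈ D := hv ▸ hF he
    have hw' : s(u, w) ∈ D := hw ▸ hF hf
    have i₁ := h₁.card_lt_card hk hD hdiag hvw hv' hw' hdu h₂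
    have i₂ := h₂.card_lt_card hk hD hdiag hvw.symm hw' hv' hdu h₁
    omega

omit [Fintype V] in
theorem sum_edegF_le {F : Finset (Sym2 V)} {h : Sym2 V → V} (hmem : ∀ e ∈ F, h e ∈ e)
    (hinj : Set.InjOn h (F : Set (Sym2 V))) {A W : Finset V} (hW : ∀ e ∈ F, (∃ a ∈ A, a ∈ e) → ∀ x ∈ e, x ∈ W) :
    ∑ x ∈ A, edegF F x ≤ W.card + A.card := by
  have h1 : ∑ x ∈ A, edegF F x = ∑ e ∈ F, (A.filter fun x => x ∈ e).card := by
    simp only [edegF, Finset.card_filter]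
    exact Finset.sum_comm
  have h2 : ∀ e ∈ F, (A.filter fun x => x ∈ e).card ≤
      (if ∃ a ∈ A, a ∈ e then 1 else 0) + (if ∀ x ∈ e, x ∈ A then 1 else 0) := by
    intro e he
    induction e with | _ a b
    have hsub : (A.filter fun x => x ∈ s(a, b)) ⊆ {a, b} := by
      intro x hx
      have := (Finset.mem_filter.1 hx).2
      simpa using this
    have hle : (A.filter fun x => x ∈ s(a, b)).card ≤ 2 :=
      (Finset.card_le_card hsub).trans Finset.card_le_two
    by_cases ht : ∃ c ∈ A, c ∈ s(a, b)
    · rw [if_pos ht]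
      by_cases hs : ∀ x ∈ s(a, b), x ∈ A
      · rw [if_pos hs]; exact hle
      · rw [if_neg hs]
        push Not at hs
        obtain ⟨y, hy, hyA⟩ := hs
        have : (A.filter fun x => x ∈ s(a, b)) ⊆ ({a, b} : Finset V).erase y := by
          intro x hx
          refine Finset.mem_erase.2 ⟨?_, hsub hx⟩
          rintro rfl
          exact hyA (Finset.mem_filter.1 hx).1
        refine (Finset.card_le_card this).trans ?_
        rw [Finset.card_erase_of_mem (by simpa using hy)]
        have := Finset.card_le_two (a := a) (b := b)
        omega
    · have : (A.filter fun x => x ∈ s(a, b)) = ∅ := by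
        refine Finset.filter_eq_empty_iff.2 fun x hx hxe => ht ⟨x, hx, hxe⟩
      rw [this]; simp
  have h3 : (F.filter fun e => ∃ a ∈ A, a ∈ e).card ≤ W.card := by
    refine Finset.card_le_card_of_injOn h (fun e he => ?_) (hinj.mono fun e he => ?_)
    · obtain ⟨he, ht⟩ := Finset.mem_filter.1 he
      exact hW e he ht _ (hmem e he)
    · exact (Finset.mem_filter.1 he).1
  have h4 : (F.filter fun e => ∀ x ∈ e, x ∈ A).card ≤ A.card := by
    refine Finset.card_le_card_of_injOn h (fun e he => ?_) (hinj.mono fun e he => ?_)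
    · obtain ⟨he, ht⟩ := Finset.mem_filter.1 he
      exact ht _ (hmem e he)
    · exact (Finset.mem_filter.1 he).1
  rw [h1]
  refine (Finset.sum_le_sum h2).trans ?_
  rw [Finset.sum_add_distrib, ← Finset.card_filter, ← Finset.card_filter]
  exact add_le_add h3 h4

omit [Fintype V] in
theorem edegF_union {E F : Finset (Sym2 V)} (h : Disjoint E F) (v : V) :
    edegF (E ∪ F) v = edegF E v + edegF F v := by
  rw [edegF, Finset.filter_union,
    Finset.card_union_of_disjoint (Finset.disjoint_filter_filter h)]
  rfl

omit [Fintype V] in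
theorem edegF_insert {F : Finset (Sym2 V)} {e : Sym2 V} (he : e ∉ F) (y : V) :
    edegF (insert e F) y = edegF F y + if y ∈ e then 1 else 0 := by
  rw [edegF, Finset.filter_insert]
  split_ifs with h
  · rw [Finset.card_insert_of_notMem (fun h' => he (Finset.mem_filter.1 h').1)]; rfl
  · rfl

/-- If replacing the edge `vu` by `xu` does not decrease the sum of squared degrees, then the degree
of `x` is at least that of `v` minus one. -/
theorem edegF_le_succ_of_sum_sq_le {F : Finset (Sym2 V)} {v u x : V}
    (hvu : s(v, u) ∈ F) (hxu : s(x, u) ∉ F) (hv : v ≠ u) (hx : x ≠ u)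
    (hle : ∑ y, edegF F y ^ 2 ≤ ∑ y, edegF (insert s(x, u) (F.erase s(v, u))) y ^ 2) :
    edegF F v ≤ edegF F x + 1 := by
  have hxv : x ≠ v := by
    rintro rfl
    exact hxu hvu
  have h1 : ∀ y, edegF F y = edegF (F.erase s(v, u)) y + if y ∈ s(v, u) then 1 else 0 := by
    intro y
    rw [← edegF_insert (Finset.notMem_erase _ _), Finset.insert_erase hvu]
  have h2 : ∀ y, edegF (insert s(x, u) (F.erase s(v, u))) y =
      edegF (F.erase s(v, u)) y + if y ∈ s(x, u) then 1 else 0 :=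
    fun y => edegF_insert (fun h => hxu (Finset.mem_of_mem_erase h)) y
  have hdec : ∀ f : V → ℕ, ∑ y, f y = f v + (f x + ∑ y ∈ (Finset.univ.erase v).erase x, f y) := by
    intro f
    rw [Finset.add_sum_erase _ f (Finset.mem_erase.2 ⟨hxv, Finset.mem_univ _⟩),
      Finset.add_sum_erase _ f (Finset.mem_univ _)]
  rw [hdec, hdec] at hle
  have hrest : ∑ y ∈ (Finset.univ.erase v).erase x, edegF F y ^ 2 =
      ∑ y ∈ (Finset.univ.erase v).erase x,
        edegF (insert s(x, u) (F.erase s(v, u))) y ^ 2 := by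
    refine Finset.sum_congr rfl fun y hy => ?_
    simp only [Finset.mem_erase, Finset.mem_univ, and_true] at hy
    rw [h1, h2]
    simp only [Sym2.mem_iff, hy.1, hy.2, false_or]
  rw [hrest, h2 v, h2 x] at hle
  have hv1 := h1 v
  have hx1 := h1 x
  simp only [Sym2.mem_iff, hxv, hxv.symm, hv, hx, true_or, or_self, if_true, if_false] at *
  rw [hv1, hx1] at hle ⊢
  nlinarith

theorem stmt_13 (k : ℕ) (hk : 1 ≤ k)
    (E F : Finset (Sym2 V)) (hdisj : Disjoint E F)
    (hsimple : ∀ e ∈ E ∪ F, ¬ e.IsDiag)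
    (hconn : KConnected k (E ∪ F))
    (hEdeg : ∀ v : V, k - 1 ≤ edegF E v) :
    ∃ F' : Finset (Sym2 V), (∀ e ∈ F', ¬ e.IsDiag) ∧ F'.card ≤ F.card ∧
      KConnected k (E ∪ F') ∧
      ∀ v : V, (edegF F' v : ℝ) ≤ max 3 (3 / 2 + Real.sqrt (2 * (k : ℝ) + 1 / 4)) := by
  let 𝒮 : Finset (Finset (Sym2 V)) :=
    Finset.univ.filter fun F' => (∀ e ∈ F', ¬ e.IsDiag) ∧ KConnected k (E ∪ F')
  have mem𝒮 : ∀ F', F' ∈ 𝒮 ↔ (∀ e ∈ F', ¬ e.IsDiag) ∧ KConnected k (E ∪ F') := by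
    intro F'; simp [𝒮]
  have hF𝒮 : F ∈ 𝒮 := (mem𝒮 F).2 ⟨fun e he => hsimple e (Finset.mem_union_right _ he), hconn⟩
  obtain ⟨F₀, hF₀, hF₀min⟩ := Finset.exists_min_image 𝒮 Finset.card ⟨F, hF𝒮⟩
  obtain ⟨F', hF', hF'min⟩ := Finset.exists_min_image (𝒮.filter fun F' => F'.card = F₀.card)
    (fun F' => ∑ y, edegF F' y ^ 2) ⟨F₀, Finset.mem_filter.2 ⟨hF₀, rfl⟩⟩
  obtain ⟨hF'𝒮, hF'card⟩ := Finset.mem_filter.1 hF'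
  obtain ⟨hF'diag, hD⟩ := (mem𝒮 F').1 hF'𝒮
  refine ⟨F', hF'diag, hF'card ▸ hF₀min F hF𝒮, hD, fun v => ?_⟩
  have herase : ∀ e ∈ F', ¬ KConnected k (E ∪ F'.erase e) := by
    intro e he hcon
    have := hF₀min _ ((mem𝒮 (F'.erase e)).2
      ⟨fun f hf => hF'diag f (Finset.mem_of_mem_erase hf), hcon⟩)
    have := Finset.card_erase_lt_of_mem he
    omega
  have hdisj' : Disjoint E F' := by
    rw [Finset.disjoint_left]
    intro e heE heF
    refine herase e heF ?_
    have : E ∪ F'.erase e = E ∪ F' := by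
      ext f
      by_cases hfe : f = e
      · subst hfe; simp [heE]
      · simp [hfe]
    rwa [this]
  have hDerase : ∀ e ∈ F', (E ∪ F').erase e = E ∪ F'.erase e := by
    intro e he
    have heE : e ∉ E := fun h => Finset.disjoint_left.1 hdisj' h he
    rw [Finset.erase_union_distrib, Finset.erase_eq_of_notMem heE]
  have hcrit : ∀ e ∈ F', ¬ KConnected k ((E ∪ F').erase e) := fun e he => by
    rw [hDerase e he]; exact herase e he
  have hDdiag : ∀ e ∈ E ∪ F', ¬ e.IsDiag := by
    intro e he
    rcases Finset.mem_union.1 he with he | he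
    · exact hsimple e (Finset.mem_union_left _ he)
    · exact hF'diag e he
  have hDdeg : ∀ y, k - 1 + edegF F' y ≤ edegF (E ∪ F') y := fun y => by
    rw [edegF_union hdisj']
    exact Nat.add_le_add_right (hEdeg y) _
  by_cases hd : edegF F' v ≤ 3
  · exact le_max_of_le_left (by exact_mod_cast hd)
  refine le_max_of_le_right ?_
  push Not at hd
  obtain ⟨h, hmem, hinj⟩ := hD.exists_injOn_end hk hDdiag Finset.subset_union_right hcrit
    fun y hy => by have := hDdeg y; omega
  obtain ⟨e, he⟩ : (F'.filter fun e => v ∈ e).Nonempty := Finset.card_pos.1 (by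
    change 0 < edegF F' v; omega)
  obtain ⟨heF, hve⟩ := Finset.mem_filter.1 he
  obtain ⟨u, rfl⟩ := Sym2.mem_iff_exists.1 hve
  have hvu : v ≠ u := fun h => hF'diag _ heF (Sym2.mk_isDiag_iff.2 h)
  obtain ⟨A₀, B₀, hAB₀⟩ := hD.exists_tightPair hk (hcrit _ heF)
  obtain ⟨A, hA, hAmin⟩ := Finset.exists_min_image
    (Finset.univ.filter fun A => ∃ B, TightPair k (E ∪ F') v u A B) Finset.card
    ⟨A₀, Finset.mem_filter.2 ⟨Finset.mem_univ _, B₀, hAB₀⟩⟩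
  obtain ⟨B, hAB⟩ := (Finset.mem_filter.1 hA).2
  have huA : u ∉ A := fun h => Finset.disjoint_left.1 hAB.disj h hAB.right_mem
  have hvB : v ∉ B := Finset.disjoint_left.1 hAB.disj hAB.left_mem
  have hdegA : ∀ x ∈ A, edegF F' v ≤ edegF F' x + 1 := by
    intro x hx
    by_cases hxv : x = v
    · subst hxv; omega
    have hxu : x ≠ u := fun h => huA (h ▸ hx)
    have hxuF : s(x, u) ∉ E ∪ F' := fun hmem => hAB.noEdge x hx u hAB.right_mem
      (Finset.mem_erase.2 ⟨fun h => hxv (Sym2.congr_left.1 h), hmem⟩)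
    have hxuF' : s(x, u) ∉ F' := fun h => hxuF (Finset.mem_union_right _ h)
    refine edegF_le_succ_of_sum_sq_le heF hxuF' hvu hxu
      (hF'min _ (Finset.mem_filter.2 ⟨(mem𝒮 _).2 ⟨?_, ?_⟩, ?_⟩))
    · intro f hf
      rcases Finset.mem_insert.1 hf with rfl | hf
      · exact fun h => hxu (Sym2.mk_isDiag_iff.1 h)
      · exact hF'diag f (Finset.mem_of_mem_erase hf)
    · have := hD.exchange hk hAB (fun A' B' h' =>
        hAmin A' (Finset.mem_filter.2 ⟨Finset.mem_univ _, B', h'⟩)) hx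
      rwa [hDerase _ heF, ← Finset.union_insert] at this
    · rw [Finset.card_insert_of_notMem (fun h => hxuF' (Finset.mem_of_mem_erase h)),
        Finset.card_erase_add_one heF, hF'card]
  have hcard := hAB.card
  have hBpos : 0 < B.card := Finset.card_pos.2 ⟨u, hAB.right_mem⟩
  have hAd : edegF F' v ≤ A.card := by
    have h1 := edegF_add_card_lt hDdiag (u := v) (Z := B.erase u)
      (fun h => hvB (Finset.mem_of_mem_erase h)) (by
      intro z hz hzD
      obtain ⟨hzu, hzB⟩ := Finset.mem_erase.1 hz
      exact hAB.noEdge v hAB.left_mem z hzB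
        (Finset.mem_erase.2 ⟨fun h => hzu (Sym2.congr_right.1 h), hzD⟩))
    rw [Finset.card_erase_of_mem hAB.right_mem] at h1
    have := hDdeg v
    omega
  have hsum : ∑ x ∈ A, edegF F' x ≤ (insert u Bᶜ).card + A.card := by
    refine sum_edegF_le hmem hinj fun f hf ⟨a, ha, haf⟩ x hxf => ?_
    by_contra hxW
    simp only [Finset.mem_insert, Finset.mem_compl, not_or, not_not] at hxW
    obtain ⟨hxu, hxB⟩ := hxW
    have hax : a ≠ x := fun h => Finset.disjoint_left.1 hAB.disj ha (h ▸ hxB)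
    have hfe : f = s(a, x) := (Sym2.mem_and_mem_iff hax).1 ⟨haf, hxf⟩
    refine hAB.noEdge a ha x hxB (Finset.mem_erase.2
      ⟨fun h => ?_, Finset.mem_union_right _ (hfe ▸ hf)⟩)
    rcases Sym2.eq_iff.1 h with h | h
    · exact hxu h.2
    · exact hvB (h.2 ▸ hxB)
  rw [Finset.card_insert_of_notMem (by simpa using hAB.right_mem), Finset.card_compl] at hsum
  have hBle : B.card ≤ Fintype.card V := Finset.card_le_univ B
  have hlow : A.card * (edegF F' v - 1) ≤ ∑ x ∈ A, edegF F' x := by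
    rw [← smul_eq_mul]
    exact Finset.card_nsmul_le_sum A _ _ fun x hx => by have := hdegA x hx; omega
  generalize edegF F' v = d at *
  obtain ⟨c, rfl⟩ : ∃ c, d = c + 4 := ⟨d - 4, by omega⟩
  have hle : A.card * (c + 3) ≤ 2 * A.card + k := by
    have : c + 4 - 1 = c + 3 := by omega
    rw [this] at hlow
    omega
  have hck : (c + 4) * (c + 1) ≤ k := by nlinarith
  have hckR : ((c : ℝ) + 4) * (c + 1) ≤ k := by exact_mod_cast hck
  have hc0 : (0 : ℝ) ≤ c := Nat.cast_nonneg c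
  have : ((c : ℝ) + 4 - 3 / 2) ≤ Real.sqrt (2 * (k : ℝ) + 1 / 4) :=
    Real.le_sqrt_of_sq_le (by nlinarith)
  push_cast
  linarith
end
end

section
/- Let k be a positive integer and let G = (V, E ∪ F) be a simple k-connected digraph, where E and F are disjoint arc sets, such that |δ⁻_E(v)| ≥ k−1 and |δ⁺_E(v)| ≥ k−1 for all v ∈ V. Then there exists a set F' of arcs on V with |F'| ≤ |F| such that the digraph (V, E ∪ F') is k-connected and both |δ⁺_{F'}(v)| ≤ max{3, 1.5 + √(2k + 1.25)} and |δ⁻_{F'}(v)| ≤ max{3, 1.5 + √(2k + 1.25)} hold for all v ∈ V. -/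
noncomputable section

attribute [local instance] Classical.propDecidable

variable {V : Type*} [Fintype V] [DecidableEq V]

/-- A digraph given by its arc set `A` is `k`-connected: `|V| ≥ k+1` and
after deleting any set `X` of at most `k-1` vertices, the remaining digraph is
strongly connected (every remaining vertex reaches every other one by a directed
path avoiding `X`). -/
def DiKConnected (k : ℕ) (A : Finset (V × V)) : Prop :=
  k + 1 ≤ Fintype.card V ∧
    ∀ X : Finset V, X.card ≤ k - 1 →
      ∀ u v : V, u ∉ X → v ∉ X →
        Relation.ReflTransGen (fun a b : V => (a, b) ∈ A ∧ a ∉ X ∧ b ∉ X) u v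

/-- `δ⁺_F(v)`: number of arcs of `F` with tail `v`. -/
def outdegF (F : Finset (V × V)) (v : V) : ℕ := (F.filter fun a => a.1 = v).card

/-- `δ⁻_F(v)`: number of arcs of `F` with head `v`. -/
def indegF (F : Finset (V × V)) (v : V) : ℕ := (F.filter fun a => a.2 = v).card

/-- Every pair of disjoint nonempty sets `X`, `Y` missing at most `K` vertices is joined by an arc
from `X` to `Y`. -/
def NoCut (K : ℕ) (A : Finset (V × V)) : Prop :=
  ∀ X Y : Finset V, Disjoint X Y → X.Nonempty → Y.Nonempty →
    Fintype.card V ≤ X.card + Y.card + K → ∃ x ∈ X, ∃ y ∈ Y, (x, y) ∈ A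

/-- `(X, Y)` is a pair missing at most `K` vertices for which `a` is the only arc from `X`
to `Y`. -/
structure Crit (K : ℕ) (A : Finset (V × V)) (a : V × V) (X Y : Finset V) : Prop where
  disj : Disjoint X Y
  tail : a.1 ∈ X
  head : a.2 ∈ Y
  card : Fintype.card V ≤ X.card + Y.card + K
  only : ∀ x ∈ X, ∀ y ∈ Y, (x, y) ∈ A → (x, y) = a

/-- The arc set with all arcs reversed. -/
def rev (A : Finset (V × V)) : Finset (V × V) := A.map (Equiv.prodComm V V).toEmbedding

/-- The sum of the squares of all out- and in-degrees. -/
def potential (F : Finset (V × V)) : ℕ := ∑ v, outdegF F v ^ 2 + ∑ v, indegF F v ^ 2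

/-- `F` is a loopless augmentation of `E` without small cuts, whose potential is minimum among all
such augmentations with at most as many arcs. -/
structure Opt (K : ℕ) (E F : Finset (V × V)) : Prop where
  loopless : ∀ a ∈ E ∪ F, a.1 ≠ a.2
  noCut : NoCut K (E ∪ F)
  min : ∀ F' : Finset (V × V), (∀ a ∈ F', a.1 ≠ a.2) → F'.card ≤ F.card → NoCut K (E ∪ F') →
    potential F ≤ potential F'

lemma mem_rev {A : Finset (V × V)} {a : V × V} : a ∈ rev A ↔ a.swap ∈ A := by
  unfold rev
  rw [Finset.mem_map_equiv]
  rfl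

lemma rev_rev (A : Finset (V × V)) : rev (rev A) = A := by
  ext a; simp [mem_rev]

lemma rev_union (A B : Finset (V × V)) : rev (A ∪ B) = rev A ∪ rev B := by
  ext a; simp [mem_rev]

lemma card_rev (A : Finset (V × V)) : (rev A).card = A.card := Finset.card_map _

lemma outdegF_rev (A : Finset (V × V)) (v : V) : outdegF (rev A) v = indegF A v := by
  unfold outdegF indegF
  rw [← card_rev (A.filter _)]
  congr 1
  ext a; simp [mem_rev]

lemma indegF_rev (A : Finset (V × V)) (v : V) : indegF (rev A) v = outdegF A v := by
  rw [← outdegF_rev, rev_rev]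

lemma potential_rev (A : Finset (V × V)) : potential (rev A) = potential A := by
  simp only [potential, outdegF_rev, indegF_rev]
  exact add_comm _ _

lemma NoCut.rev {K : ℕ} {A : Finset (V × V)} (h : NoCut K A) : NoCut K (rev A) := by
  intro X Y hd hX hY hc
  obtain ⟨y, hy, x, hx, hm⟩ := h Y X hd.symm hY hX (by omega)
  exact ⟨x, hx, y, hy, mem_rev.2 hm⟩

lemma Crit.rev {K : ℕ} {A : Finset (V × V)} {a : V × V} {X Y : Finset V} (h : Crit K A a X Y) :
    Crit K (rev A) a.swap Y X where
  disj := h.disj.symm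
  tail := h.head
  head := h.tail
  card := by have := h.card; omega
  only := fun y hy x hx hm => by
    have := h.only x hx y hy (mem_rev.1 hm)
    rw [← this]; rfl

lemma Opt.rev {K : ℕ} {E F : Finset (V × V)} (h : Opt K E F) : Opt K (rev E) (rev F) where
  loopless := fun a ha => by
    rw [← rev_union, mem_rev] at ha
    exact (h.loopless _ ha).symm
  noCut := by rw [← rev_union]; exact h.noCut.rev
  min := fun F' hl hc hn => by
    rw [potential_rev, ← potential_rev F']
    refine h.min _ (fun a ha => (hl _ (mem_rev.1 ha)).symm) (by simpa only [card_rev] using hc) ?_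
    have := hn.rev
    rwa [rev_union, rev_rev] at this

lemma DiKConnected.noCut {K : ℕ} {A : Finset (V × V)} (h : DiKConnected (K + 1) A) :
    NoCut K A := by
  intro X Y hd ⟨x, hx⟩ ⟨y, hy⟩ hc
  by_contra! hno
  have hcard : (X ∪ Y)ᶜ.card ≤ K + 1 - 1 := by
    rw [Finset.card_compl, Finset.card_union_of_disjoint hd]; omega
  have hp := h.2 (X ∪ Y)ᶜ hcard x y (by simp [hx]) (by simp [hy])
  have hyX : y ∈ X := by
    clear hy
    induction hp with
    | refl => exact hx
    | tail _ hs ih =>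
      obtain ⟨h1, -, h3⟩ := hs
      simp only [Finset.mem_compl, not_not, Finset.mem_union] at h3
      exact h3.resolve_right fun hY => hno _ ih _ hY h1
  exact Finset.disjoint_left.1 hd hyX hy

lemma NoCut.diKConnected {K : ℕ} {A : Finset (V × V)} (h : NoCut K A)
    (hV : K + 2 ≤ Fintype.card V) : DiKConnected (K + 1) A := by
  refine ⟨hV, fun Z hZ u v hu hv => ?_⟩
  by_contra hnr
  set r := fun a b : V => (a, b) ∈ A ∧ a ∉ Z ∧ b ∉ Z with hr
  let X : Finset V := Finset.univ.filter fun p => Relation.ReflTransGen r u p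
  have hXZ : ∀ p ∈ X, p ∉ Z := by
    intro p hp
    rcases Relation.ReflTransGen.cases_tail (Finset.mem_filter.1 hp).2 with h0 | ⟨q, -, hq⟩
    · exact h0 ▸ hu
    · exact hq.2.2
  have hdXZ : Disjoint X Z := Finset.disjoint_left.2 hXZ
  obtain ⟨x, hx, y, hy, hm⟩ := h X (X ∪ Z)ᶜ
    (Finset.disjoint_left.2 fun p hp hp' => by simp [hp] at hp')
    ⟨u, by simp [X, Relation.ReflTransGen.refl]⟩
    ⟨v, by simp [X, hv, hnr]⟩
    (by rw [Finset.card_compl, Finset.card_union_of_disjoint hdXZ]; omega)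
  have hyZ : y ∉ X ∧ y ∉ Z := by simpa using hy
  exact hyZ.1 (Finset.mem_filter.2 ⟨Finset.mem_univ _,
    (Finset.mem_filter.1 hx).2.tail ⟨hm, hXZ x hx, hyZ.2⟩⟩)

lemma outdegF_eq_card_image (A : Finset (V × V)) (x : V) :
    outdegF A x = (Finset.univ.filter fun y => (x, y) ∈ A).card := by
  unfold outdegF
  refine Finset.card_bij' (fun a _ => a.2) (fun y _ => (x, y)) ?_ ?_ ?_ ?_
  · rintro ⟨p, q⟩ h
    obtain ⟨h1, rfl⟩ := Finset.mem_filter.1 h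
    simpa using h1
  · intro y h; simpa using h
  · rintro ⟨p, q⟩ h
    obtain ⟨h1, rfl⟩ := Finset.mem_filter.1 h
    rfl
  · intro y h; rfl

lemma outdegF_union {E F : Finset (V × V)} (h : Disjoint E F) (v : V) :
    outdegF (E ∪ F) v = outdegF E v + outdegF F v := by
  unfold outdegF
  rw [Finset.filter_union, Finset.card_union_of_disjoint (Finset.disjoint_filter_filter h)]

/-- Only one arc from `X` to `Y` forces at least `K` missing vertices. -/
lemma NoCut.card_le_of_only {K : ℕ} {A : Finset (V × V)} (h : NoCut K A)
    (hV : K + 2 ≤ Fintype.card V) {a : V × V} {X Y : Finset V} (hd : Disjoint X Y)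
    (ha1 : a.1 ∈ X) (ha2 : a.2 ∈ Y) (only : ∀ x ∈ X, ∀ y ∈ Y, (x, y) ∈ A → (x, y) = a) :
    X.card + Y.card + K ≤ Fintype.card V := by
  by_contra! hlt
  have hX := Finset.card_erase_of_mem ha1
  have hY := Finset.card_erase_of_mem ha2
  have hX0 := Finset.card_pos.2 ⟨_, ha1⟩
  have hY0 := Finset.card_pos.2 ⟨_, ha2⟩
  by_cases hX1 : (X.erase a.1).Nonempty
  · obtain ⟨x, hx, y, hy, hm⟩ := h (X.erase a.1) Y (hd.mono_left (Finset.erase_subset _ _)) hX1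
      ⟨_, ha2⟩ (by omega)
    obtain ⟨hx1, hx2⟩ := Finset.mem_erase.1 hx
    exact hx1 (congrArg Prod.fst (only x hx2 y hy hm))
  by_cases hY1 : (Y.erase a.2).Nonempty
  · obtain ⟨x, hx, y, hy, hm⟩ := h X (Y.erase a.2) (hd.mono_right (Finset.erase_subset _ _))
      ⟨_, ha1⟩ hY1 (by omega)
    obtain ⟨hy1, hy2⟩ := Finset.mem_erase.1 hy
    exact hy1 (congrArg Prod.snd (only x hx y hy2 hm))
  rw [Finset.not_nonempty_iff_eq_empty, ← Finset.card_eq_zero] at hX1 hY1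
  omega

/-- Critical pairs of an arc are closed under crossing. -/
lemma Crit.inter {K : ℕ} {A : Finset (V × V)} (h : NoCut K A) (hV : K + 2 ≤ Fintype.card V)
    {a : V × V} {X₁ Y₁ X₂ Y₂ : Finset V} (h₁ : Crit K A a X₁ Y₁) (h₂ : Crit K A a X₂ Y₂) :
    Crit K A a (X₁ ∩ X₂) (Y₁ ∪ Y₂) := by
  have hd1 := Finset.disjoint_left.1 h₁.disj
  have hd2 := Finset.disjoint_left.1 h₂.disj
  have hle := h.card_le_of_only hV (a := a) (X := X₁ ∪ X₂) (Y := Y₁ ∩ Y₂)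
    (Finset.disjoint_left.2 fun p hp hq => by
      rcases Finset.mem_union.1 hp with hp | hp
      · exact hd1 hp (Finset.mem_inter.1 hq).1
      · exact hd2 hp (Finset.mem_inter.1 hq).2)
    (Finset.mem_union_left _ h₁.tail) (Finset.mem_inter.2 ⟨h₁.head, h₂.head⟩)
    (fun x hx y hy hm => by
      rcases Finset.mem_union.1 hx with hx | hx
      · exact h₁.only x hx y (Finset.mem_inter.1 hy).1 hm
      · exact h₂.only x hx y (Finset.mem_inter.1 hy).2 hm)
  have hX := Finset.card_union_add_card_inter X₁ X₂
  have hY := Finset.card_union_add_card_inter Y₁ Y₂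
  have hc1 := h₁.card
  have hc2 := h₂.card
  refine ⟨Finset.disjoint_left.2 fun p hp hq => ?_, Finset.mem_inter.2 ⟨h₁.tail, h₂.tail⟩,
    Finset.mem_union_left _ h₁.head, by omega, fun x hx y hy hm => ?_⟩
  · rcases Finset.mem_union.1 hq with hq | hq
    · exact hd1 (Finset.mem_inter.1 hp).1 hq
    · exact hd2 (Finset.mem_inter.1 hp).2 hq
  · rcases Finset.mem_union.1 hy with hy | hy
    · exact h₁.only x (Finset.mem_inter.1 hx).1 y hy hm
    · exact h₂.only x (Finset.mem_inter.1 hx).2 y hy hm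

lemma Crit.card_inter_add_card_union_le {K : ℕ} {A : Finset (V × V)} (h : NoCut K A)
    (hl : ∀ a ∈ A, a.1 ≠ a.2) {a b : V × V} {X₁ Y₁ X₂ Y₂ : Finset V}
    (h₁ : Crit K A a X₁ Y₁) (h₂ : Crit K A b X₂ Y₂) (ht : a.1 = b.1)
    (hdeg : K + 2 ≤ outdegF A a.1) :
    (X₁ ∩ X₂).card + (Y₁ ∪ Y₂).card + K ≤ Fintype.card V := by
  have hxm : a.1 ∈ X₁ ∩ X₂ := Finset.mem_inter.2 ⟨h₁.tail, ht ▸ h₂.tail⟩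
  have hd : Disjoint (X₁ ∩ X₂) (Y₁ ∪ Y₂) := Finset.disjoint_left.2 fun p hp hq => by
    rcases Finset.mem_union.1 hq with hq | hq
    · exact Finset.disjoint_left.1 h₁.disj (Finset.mem_inter.1 hp).1 hq
    · exact Finset.disjoint_left.1 h₂.disj (Finset.mem_inter.1 hp).2 hq
  have honly : ∀ x ∈ X₁ ∩ X₂, ∀ y ∈ Y₁ ∪ Y₂, (x, y) ∈ A → (x, y) = a ∨ (x, y) = b := by
    intro x hx y hy hm
    rcases Finset.mem_union.1 hy with hy | hy
    · exact Or.inl (h₁.only x (Finset.mem_inter.1 hx).1 y hy hm)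
    · exact Or.inr (h₂.only x (Finset.mem_inter.1 hx).2 y hy hm)
  have hpos := Finset.card_pos.2 ⟨_, hxm⟩
  have her := Finset.card_erase_of_mem hxm
  by_cases hne : ((X₁ ∩ X₂).erase a.1).Nonempty
  · by_contra! hlt
    obtain ⟨x, hx, y, hy, hm⟩ := h _ (Y₁ ∪ Y₂) (hd.mono_left (Finset.erase_subset a.1 _)) hne
      ⟨_, Finset.mem_union_left _ h₁.head⟩ (by omega)
    obtain ⟨hx1, hx2⟩ := Finset.mem_erase.1 hx
    rcases honly x hx2 y hy hm with he | he
    · exact hx1 (congrArg Prod.fst he)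
    · exact hx1 ((congrArg Prod.fst he).trans ht.symm)
  · rw [Finset.not_nonempty_iff_eq_empty, ← Finset.card_eq_zero] at hne
    rw [outdegF_eq_card_image] at hdeg
    have hsub : (Finset.univ.filter fun y => (a.1, y) ∈ A) ⊆
        ((X₁ ∩ X₂) ∪ (Y₁ ∪ Y₂))ᶜ ∪ {a.2, b.2} := by
      intro y hy
      have hm : (a.1, y) ∈ A := (Finset.mem_filter.1 hy).2
      by_cases hyY : y ∈ Y₁ ∪ Y₂
      · refine Finset.mem_union_right _ ?_
        rcases honly _ hxm y hyY hm with he | he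
        · exact Finset.mem_insert.2 (Or.inl (congrArg Prod.snd he))
        · exact Finset.mem_insert_of_mem (Finset.mem_singleton.2 (congrArg Prod.snd he))
      · refine Finset.mem_union_left _ ?_
        have hyX : y ∉ X₁ ∩ X₂ := by
          intro hyX
          have := (Finset.card_le_one.1 (by omega : (X₁ ∩ X₂).card ≤ 1)) _ hxm _ hyX
          exact hl _ hm this
        rw [Finset.mem_compl, Finset.mem_union]
        tauto
    have h1 := Finset.card_le_card hsub
    have h2 := Finset.card_union_le ((X₁ ∩ X₂) ∪ (Y₁ ∪ Y₂))ᶜ {a.2, b.2}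
    have h3 : ({a.2, b.2} : Finset V).card ≤ 2 := Finset.card_le_two
    have h4 := Finset.card_add_card_compl ((X₁ ∩ X₂) ∪ (Y₁ ∪ Y₂))
    rw [Finset.card_union_of_disjoint hd] at h4
    omega

/-- Critical arcs with a common tail of large out-degree: each source side is larger than the
other sink side. -/
lemma Crit.card_lt_of_common_tail {K : ℕ} {A : Finset (V × V)} (h : NoCut K A)
    (hl : ∀ a ∈ A, a.1 ≠ a.2) {a b : V × V} {X₁ Y₁ X₂ Y₂ : Finset V}
    (h₁ : Crit K A a X₁ Y₁) (h₂ : Crit K A b X₂ Y₂) (hab : a ≠ b)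
    (ht : a.1 = b.1) (hdeg : K + 2 ≤ outdegF A a.1) : Y₂.card < X₁.card := by
  have hle := h₁.card_inter_add_card_union_le h hl h₂ ht hdeg
  have hX := Finset.card_union_add_card_inter X₁ X₂
  have hY := Finset.card_union_add_card_inter Y₁ Y₂
  have hc1 := h₁.card
  have hc2 := h₂.card
  have hpos := Finset.card_pos.2 ⟨a.1, Finset.mem_inter.2 ⟨h₁.tail, ht ▸ h₂.tail⟩⟩
  have hYd : (Y₁ ∩ Y₂).card = 0 := by
    by_contra hne
    obtain ⟨x, hx, y, hy, hm⟩ := h (X₁ ∪ X₂) (Y₁ ∩ Y₂)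
      (Finset.disjoint_left.2 fun p hp hq => by
        rcases Finset.mem_union.1 hp with hp | hp
        · exact Finset.disjoint_left.1 h₁.disj hp (Finset.mem_inter.1 hq).1
        · exact Finset.disjoint_left.1 h₂.disj hp (Finset.mem_inter.1 hq).2)
      ⟨_, Finset.mem_union_left _ h₁.tail⟩ (Finset.card_pos.1 (by omega)) (by omega)
    obtain ⟨hy1, hy2⟩ := Finset.mem_inter.1 hy
    rcases Finset.mem_union.1 hx with hx | hx
    · have he := h₁.only x hx y hy1 hm
      have hx2 : x = b.1 := (congrArg Prod.fst he).trans ht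
      exact hab (he.symm.trans (h₂.only x (hx2 ▸ h₂.tail) y hy2 hm))
    · have he := h₂.only x hx y hy2 hm
      have hx1 : x = a.1 := (congrArg Prod.fst he).trans ht.symm
      exact hab ((h₁.only x (hx1 ▸ h₁.tail) y hy1 hm).symm.trans he)
  omega

lemma Crit.card_lt_of_common_head {K : ℕ} {A : Finset (V × V)} (h : NoCut K A)
    (hl : ∀ a ∈ A, a.1 ≠ a.2) {a b : V × V} {X₁ Y₁ X₂ Y₂ : Finset V}
    (h₁ : Crit K A a X₁ Y₁) (h₂ : Crit K A b X₂ Y₂) (hab : a ≠ b)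
    (ht : a.2 = b.2) (hdeg : K + 2 ≤ indegF A a.2) : X₂.card < Y₁.card :=
  h₁.rev.card_lt_of_common_tail h.rev (fun c hc => (hl _ (mem_rev.1 hc)).symm) h₂.rev
    (fun he => hab (Prod.swap_injective he)) ht
    (by rw [outdegF_rev]; exact hdeg)

lemma outdegF_erase {F : Finset (V × V)} {a : V × V} (ha : a ∈ F) (v : V) :
    outdegF (F.erase a) v + (if a.1 = v then 1 else 0) = outdegF F v := by
  unfold outdegF
  rw [Finset.filter_erase]
  split_ifs with h
  · exact Finset.card_erase_add_one (Finset.mem_filter.2 ⟨ha, h⟩)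
  · rw [Finset.erase_eq_of_notMem (by simp [h]), add_zero]

lemma outdegF_insert {F : Finset (V × V)} {a : V × V} (ha : a ∉ F) (v : V) :
    outdegF (insert a F) v = outdegF F v + (if a.1 = v then 1 else 0) := by
  rw [← outdegF_erase (Finset.mem_insert_self a F), Finset.erase_insert ha]

lemma rev_erase (F : Finset (V × V)) (a : V × V) : rev (F.erase a) = (rev F).erase a.swap := by
  ext c; simp [mem_rev, Prod.swap_eq_iff_eq_swap]

lemma indegF_erase {F : Finset (V × V)} {a : V × V} (ha : a ∈ F) (v : V) :
    indegF (F.erase a) v + (if a.2 = v then 1 else 0) = indegF F v := by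
  rw [← outdegF_rev, ← outdegF_rev, rev_erase]
  exact outdegF_erase (F := rev F) (a := a.swap) (mem_rev.2 ha) v

lemma indegF_insert {F : Finset (V × V)} {a : V × V} (ha : a ∉ F) (v : V) :
    indegF (insert a F) v = indegF F v + (if a.2 = v then 1 else 0) := by
  rw [← indegF_erase (Finset.mem_insert_self a F), Finset.erase_insert ha]

lemma potential_erase_lt {F : Finset (V × V)} {a : V × V} (ha : a ∈ F) :
    potential (F.erase a) < potential F := by
  have ho : ∀ v, outdegF (F.erase a) v ≤ outdegF F v := fun v => by
    have := outdegF_erase ha v; omega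
  have hi : ∀ v, indegF (F.erase a) v ≤ indegF F v := fun v => by
    have := indegF_erase ha v; omega
  unfold potential
  refine add_lt_add_of_lt_of_le (Finset.sum_lt_sum (fun v _ => Nat.pow_le_pow_left (ho v) 2)
    ⟨a.1, Finset.mem_univ _, ?_⟩) (Finset.sum_le_sum fun v _ => Nat.pow_le_pow_left (hi v) 2)
  refine Nat.pow_lt_pow_left ?_ two_ne_zero
  have := outdegF_erase ha a.1
  rw [if_pos rfl] at this
  omega

/-- Moving the tail of an arc to a vertex of much smaller out-degree lowers the potential. -/
lemma potential_move_lt {F : Finset (V × V)} {a : V × V} (ha : a ∈ F) {x : V}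
    (hx : (x, a.2) ∉ F) (hdeg : outdegF F x + 1 < outdegF F a.1) :
    potential (insert (x, a.2) (F.erase a)) < potential F := by
  have hx' : (x, a.2) ∉ F.erase a := fun h => hx (Finset.mem_of_mem_erase h)
  have hne : a.1 ≠ x := by rintro rfl; omega
  have hi : ∀ v, indegF (insert (x, a.2) (F.erase a)) v = indegF F v := fun v => by
    rw [indegF_insert hx', ← indegF_erase ha v]
  have ho : ∀ v, outdegF (insert (x, a.2) (F.erase a)) v + (if a.1 = v then 1 else 0) =
      outdegF F v + (if x = v then 1 else 0) := fun v => by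
    rw [outdegF_insert hx', ← outdegF_erase ha v]; ring
  have key : ∀ v, outdegF (insert (x, a.2) (F.erase a)) v ^ 2 +
      (if a.1 = v then 2 * outdegF F a.1 - 1 else 0) =
      outdegF F v ^ 2 + (if x = v then 2 * outdegF F x + 1 else 0) := fun v => by
    have h := ho v
    by_cases h1 : a.1 = v
    · subst h1
      simp only [if_pos, if_neg hne.symm] at h ⊢
      obtain ⟨c, hc⟩ : ∃ c, outdegF F a.1 = c + 1 := ⟨outdegF F a.1 - 1, by omega⟩
      rw [hc] at h ⊢
      have h' : outdegF (insert (x, a.2) (F.erase a)) a.1 = c := by omega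
      rw [h', show 2 * (c + 1) - 1 = 2 * c + 1 by omega]
      ring
    · by_cases h2 : x = v
      · subst h2
        simp only [if_pos, if_neg h1] at h ⊢
        rw [add_zero] at h
        rw [h]; ring
      · simp only [if_neg h1, if_neg h2, add_zero] at h ⊢
        rw [h]
  have hsum := Finset.sum_congr (rfl : (Finset.univ : Finset V) = Finset.univ)
    fun v _ => key v
  simp only [Finset.sum_add_distrib, Finset.sum_ite_eq, Finset.mem_univ, if_true] at hsum
  unfold potential
  simp only [hi]
  omega

namespace Opt

variable {K : ℕ} {E F : Finset (V × V)}

lemma disjoint (h : Opt K E F) : Disjoint E F := by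
  rw [Finset.disjoint_left]
  intro a haE haF
  refine (potential_erase_lt haF).not_ge (h.min _ (fun c hc => h.loopless c
    (Finset.mem_union_right _ (Finset.mem_of_mem_erase hc))) (Finset.card_erase_le) ?_)
  convert h.noCut using 1
  ext c
  by_cases hc : c = a
  · simp [hc, haE]
  · simp [hc]

lemma exists_crit (h : Opt K E F) {a : V × V} (ha : a ∈ F) :
    ∃ X Y, Crit K (E ∪ F) a X Y := by
  by_contra! hno
  refine (potential_erase_lt ha).not_ge (h.min _ (fun c hc => h.loopless c
    (Finset.mem_union_right _ (Finset.mem_of_mem_erase hc))) (Finset.card_erase_le) ?_)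
  intro X Y hd hX hY hc
  by_contra! hempty
  have only : ∀ x ∈ X, ∀ y ∈ Y, (x, y) ∈ E ∪ F → (x, y) = a := by
    intro x hx y hy hm
    by_contra hne
    refine hempty x hx y hy ?_
    simpa [hne] using hm
  obtain ⟨x, hx, y, hy, hm⟩ := h.noCut X Y hd hX hY hc
  have he := only x hx y hy hm
  subst he
  exact hno X Y ⟨hd, hx, hy, hc, only⟩

/-- Each new arc has a critical pair all of whose sources have almost the out-degree of the tail
of the arc. -/
lemma exists_crit_outdegF (h : Opt K E F) (hV : K + 2 ≤ Fintype.card V) {a : V × V}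
    (ha : a ∈ F) :
    ∃ X Y, Crit K (E ∪ F) a X Y ∧ ∀ x ∈ X, outdegF F a.1 ≤ outdegF F x + 1 := by
  let S : Finset (Finset V × Finset V) :=
    Finset.univ.filter fun P => Crit K (E ∪ F) a P.1 P.2
  obtain ⟨X₀, Y₀, h₀⟩ := h.exists_crit ha
  obtain ⟨⟨X, Y⟩, hS, hmin⟩ := S.exists_min_image (fun P => P.1.card)
    ⟨(X₀, Y₀), Finset.mem_filter.2 ⟨Finset.mem_univ _, h₀⟩⟩
  have hXY : Crit K (E ∪ F) a X Y := (Finset.mem_filter.1 hS).2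
  refine ⟨X, Y, hXY, fun x hx => ?_⟩
  by_contra! hlt
  have hxne : (x, a.2) ≠ a := by
    intro he
    have : x = a.1 := congrArg Prod.fst he
    subst this; omega
  have hxA : (x, a.2) ∉ E ∪ F := fun hm => hxne (hXY.only x hx a.2 hXY.head hm)
  have hxF : (x, a.2) ∉ F := fun hm => hxA (Finset.mem_union_right _ hm)
  refine (potential_move_lt ha hxF hlt).not_ge (h.min _ ?_ ?_ ?_)
  · intro c hc
    rcases Finset.mem_insert.1 hc with rfl | hc
    · exact fun he => Finset.disjoint_left.1 hXY.disj hx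
        (by simpa only [← (show x = a.2 from he)] using hXY.head)
    · exact h.loopless c (Finset.mem_union_right _ (Finset.mem_of_mem_erase hc))
  · refine (Finset.card_insert_le _ _).trans ?_
    rw [Finset.card_erase_add_one ha]
  · intro P Q hd hP hQ hc
    by_contra! hempty
    have only : ∀ p ∈ P, ∀ q ∈ Q, (p, q) ∈ E ∪ F → (p, q) = a := by
      intro p hp q hq hm
      by_contra hne
      refine hempty p hp q hq ?_
      rcases Finset.mem_union.1 hm with hm | hm
      · exact Finset.mem_union_left _ hm
      · exact Finset.mem_union_right _ (Finset.mem_insert_of_mem (Finset.mem_erase.2 ⟨hne, hm⟩))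
    obtain ⟨p, hp, q, hq, hm⟩ := h.noCut P Q hd hP hQ hc
    have he := only p hp q hq hm
    subst he
    have hPQ : Crit K (E ∪ F) (p, q) P Q := ⟨hd, hp, hq, hc, only⟩
    have hle : X.card ≤ (X ∩ P).card := hmin (X ∩ P, Y ∪ Q)
      (Finset.mem_filter.2 ⟨Finset.mem_univ _, hXY.inter h.noCut hV hPQ⟩)
    have hXP : X ∩ P = X := Finset.eq_of_subset_of_card_le Finset.inter_subset_left hle
    have hxP : x ∈ P := Finset.inter_eq_left.1 hXP hx
    exact hempty x hxP q hq (Finset.mem_union_right _ (Finset.mem_insert_self _ _))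

lemma le_outdegF_union (h : Opt K E F) (hE : ∀ v, K ≤ outdegF E v) (v : V) :
    K + outdegF F v ≤ outdegF (E ∪ F) v := by
  rw [outdegF_union h.disjoint]
  exact Nat.add_le_add_right (hE v) _

/-- There are few new arcs from a set of vertices of new out-degree at least two into any given
set of vertices. -/
lemma card_le_add (h : Opt K E F) (hEout : ∀ v, K ≤ outdegF E v) (hEin : ∀ v, K ≤ indegF E v)
    {B : Finset (V × V)} (hBF : B ⊆ F) {X W : Finset V} (hX : ∀ b ∈ B, b.1 ∈ X)
    (hW : ∀ b ∈ B, b.2 ∈ W) (hdeg : ∀ x ∈ X, 2 ≤ outdegF F x) :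
    B.card ≤ X.card + W.card := by
  choose! P Q hPQ using fun a (ha : a ∈ F) => h.exists_crit ha
  rw [← Finset.card_filter_add_card_filter_not (s := B) fun b => (P b).card ≤ (Q b).card]
  refine add_le_add ?_ ?_
  · refine Finset.card_le_card_of_injOn Prod.fst
      (fun b hb => hX b (Finset.mem_filter.1 hb).1) ?_
    intro b hb c hc hbc
    obtain ⟨hbB, hb2⟩ := Finset.mem_filter.1 hb
    obtain ⟨hcB, hc2⟩ := Finset.mem_filter.1 hc
    by_contra hne
    have hd : ∀ x ∈ X, K + 2 ≤ outdegF (E ∪ F) x := fun x hx =>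
      (Nat.add_le_add_left (hdeg x hx) K).trans (h.le_outdegF_union hEout x)
    have h1 := (hPQ b (hBF hbB)).card_lt_of_common_tail h.noCut h.loopless (hPQ c (hBF hcB)) hne
      hbc (hd _ (hX b hbB))
    have h2 := (hPQ c (hBF hcB)).card_lt_of_common_tail h.noCut h.loopless (hPQ b (hBF hbB))
      (Ne.symm hne) hbc.symm (hd _ (hX c hcB))
    omega
  · refine Finset.card_le_card_of_injOn Prod.snd
      (fun b hb => hW b (Finset.mem_filter.1 hb).1) ?_
    intro b hb c hc hbc
    obtain ⟨hbB, hb2⟩ := Finset.mem_filter.1 hb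
    obtain ⟨hcB, hc2⟩ := Finset.mem_filter.1 hc
    by_contra hne
    have hd : K + 2 ≤ indegF (E ∪ F) b.2 := by
      have h2 : 2 ≤ indegF F b.2 := by
        unfold indegF
        rw [← Finset.card_pair hne]
        refine Finset.card_le_card fun e he => ?_
        rcases Finset.mem_insert.1 he with rfl | he
        · exact Finset.mem_filter.2 ⟨hBF hbB, rfl⟩
        · rw [Finset.mem_singleton.1 he]
          exact Finset.mem_filter.2 ⟨hBF hcB, hbc.symm⟩
      have h3 := h.rev.le_outdegF_union (fun v => by rw [outdegF_rev]; exact hEin v) b.2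
      rw [← rev_union, outdegF_rev, outdegF_rev] at h3
      omega
    have h1 := (hPQ b (hBF hbB)).card_lt_of_common_head h.noCut h.loopless (hPQ c (hBF hcB)) hne
      hbc hd
    have h2 := (hPQ c (hBF hcB)).card_lt_of_common_head h.noCut h.loopless (hPQ b (hBF hbB))
      (Ne.symm hne) hbc.symm (hbc ▸ hd)
    omega

lemma outdegF_bound (h : Opt K E F) (hV : K + 2 ≤ Fintype.card V)
    (hEout : ∀ v, K ≤ outdegF E v) (hEin : ∀ v, K ≤ indegF E v) {v : V}
    (hv : 4 ≤ outdegF F v) : outdegF F v * outdegF F v ≤ K + 3 * outdegF F v := by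
  obtain ⟨a, ha⟩ := Finset.card_pos.1 (show 0 < (F.filter fun a => a.1 = v).card by
    unfold outdegF at hv; omega)
  obtain ⟨haF, rfl⟩ := Finset.mem_filter.1 ha
  obtain ⟨X, Y, hXY, hdeg⟩ := h.exists_crit_outdegF hV haF
  have hz : X.card + Y.card + K = Fintype.card V :=
    le_antisymm (h.noCut.card_le_of_only hV hXY.disj hXY.tail hXY.head hXY.only) hXY.card
  have hYc := Finset.card_add_card_compl Y
  have hsize : outdegF F a.1 ≤ X.card := by
    have h1 := h.le_outdegF_union hEout a.1
    rw [outdegF_eq_card_image (E ∪ F)] at h1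
    have hsub : (Finset.univ.filter fun y => (a.1, y) ∈ E ∪ F) ⊆
        insert a.2 (Yᶜ.erase a.1) := by
      intro y hy
      have hm : (a.1, y) ∈ E ∪ F := (Finset.mem_filter.1 hy).2
      by_cases hyY : y ∈ Y
      · have := hXY.only _ hXY.tail y hyY hm
        exact Finset.mem_insert.2 (Or.inl (congrArg Prod.snd this))
      · exact Finset.mem_insert_of_mem (Finset.mem_erase.2
          ⟨(h.loopless _ hm).symm, Finset.mem_compl.2 hyY⟩)
    have h2 := Finset.card_le_card hsub
    have h3 := Finset.card_insert_le a.2 (Yᶜ.erase a.1)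
    have h4 := Finset.card_erase_add_one
      (Finset.mem_compl.2 (Finset.disjoint_left.1 hXY.disj hXY.tail))
    omega
  let T : Finset (V × V) := F.filter fun b => b.1 ∈ X
  have haT : a ∈ T := Finset.mem_filter.2 ⟨haF, hXY.tail⟩
  have hupper : (T.erase a).card ≤ X.card + Yᶜ.card := by
    refine h.card_le_add hEout hEin
      (fun b hb => (Finset.mem_filter.1 (Finset.mem_of_mem_erase hb)).1)
      (fun b hb => (Finset.mem_filter.1 (Finset.mem_of_mem_erase hb)).2)
      (fun b hb => ?_) (fun x hx => by have := hdeg x hx; omega)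
    obtain ⟨hba, hbT⟩ := Finset.mem_erase.1 hb
    obtain ⟨hbF, hbX⟩ := Finset.mem_filter.1 hbT
    rw [Finset.mem_compl]
    exact fun hbY => hba (hXY.only b.1 hbX b.2 hbY (Finset.mem_union_right _ hbF))
  have hT : T.card = ∑ x ∈ X, outdegF F x := by
    rw [Finset.card_eq_sum_card_fiberwise (s := T) (f := Prod.fst) (t := X)
      (fun b hb => (Finset.mem_filter.1 hb).2)]
    refine Finset.sum_congr rfl fun x hx => ?_
    unfold outdegF
    congr 1
    ext b
    simp only [T, Finset.mem_filter]
    constructor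
    · rintro ⟨⟨h1, -⟩, h2⟩; exact ⟨h1, h2⟩
    · rintro ⟨h1, h2⟩; exact ⟨⟨h1, h2 ▸ hx⟩, h2⟩
  have hlower : X.card * (outdegF F a.1 - 1) + 1 ≤ T.card := by
    rw [hT, ← Finset.add_sum_erase X _ hXY.tail, ← Finset.card_erase_add_one hXY.tail]
    have hs := Finset.card_nsmul_le_sum (X.erase a.1) (fun x => outdegF F x) (outdegF F a.1 - 1)
      (fun x hx => by have := hdeg x (Finset.mem_of_mem_erase hx); omega)
    rw [smul_eq_mul] at hs
    rw [add_mul, one_mul]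
    omega
  have hTe := Finset.card_erase_add_one haT
  obtain ⟨c, hc⟩ : ∃ c, outdegF F a.1 = c + 4 := ⟨outdegF F a.1 - 4, by omega⟩
  rw [hc] at hlower hsize ⊢
  rw [show c + 4 - 1 = c + 3 by omega] at hlower
  have : X.card * (c + 3) ≤ 2 * X.card + K := by omega
  nlinarith

end Opt

lemma natCast_le_max_of_sq_le {K d : ℕ} (h : 4 ≤ d → d * d ≤ K + 3 * d) :
    (d : ℝ) ≤ max 3 (1.5 + Real.sqrt (2 * ((K + 1 : ℕ) : ℝ) + 1.25)) := by
  rcases Nat.lt_or_ge d 4 with h4 | h4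
  · exact le_max_of_le_left (by exact_mod_cast Nat.le_of_lt_succ h4)
  · refine le_max_of_le_right ?_
    have hd : (d : ℝ) * d ≤ K + 3 * d := by exact_mod_cast h h4
    have hK : (0 : ℝ) ≤ K := Nat.cast_nonneg K
    have : (d : ℝ) - 1.5 ≤ Real.sqrt (2 * ((K + 1 : ℕ) : ℝ) + 1.25) := by
      refine Real.le_sqrt_of_sq_le ?_
      push_cast
      nlinarith
    linarith

theorem stmt_15 (k : ℕ) (hk : 1 ≤ k)
    (E F : Finset (V × V)) (hdisj : Disjoint E F)
    (hsimple : ∀ a ∈ E ∪ F, a.1 ≠ a.2)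
    (hconn : DiKConnected k (E ∪ F))
    (hEin : ∀ v : V, k - 1 ≤ indegF E v)
    (hEout : ∀ v : V, k - 1 ≤ outdegF E v) :
    ∃ F' : Finset (V × V), (∀ a ∈ F', a.1 ≠ a.2) ∧ F'.card ≤ F.card ∧
      DiKConnected k (E ∪ F') ∧
      ∀ v : V, (outdegF F' v : ℝ) ≤ max 3 (1.5 + Real.sqrt (2 * (k : ℝ) + 1.25)) ∧
        (indegF F' v : ℝ) ≤ max 3 (1.5 + Real.sqrt (2 * (k : ℝ) + 1.25)) := by
  obtain ⟨K, rfl⟩ : ∃ K, k = K + 1 := ⟨k - 1, by omega⟩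
  simp only [Nat.add_sub_cancel] at hEin hEout
  have hV : K + 2 ≤ Fintype.card V := hconn.1
  let S : Finset (Finset (V × V)) := Finset.univ.filter fun F' =>
    (∀ a ∈ F', a.1 ≠ a.2) ∧ F'.card ≤ F.card ∧ NoCut K (E ∪ F')
  have hFS : F ∈ S := Finset.mem_filter.2 ⟨Finset.mem_univ _,
    fun a ha => hsimple a (Finset.mem_union_right _ ha), le_rfl, hconn.noCut⟩
  obtain ⟨F', hF', hmin⟩ := S.exists_min_image potential ⟨F, hFS⟩
  obtain ⟨-, hloop, hcard, hcut⟩ := Finset.mem_filter.1 hF'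
  have hopt : Opt K E F' :=
    { loopless := fun a ha => (Finset.mem_union.1 ha).elim
        (fun h => hsimple a (Finset.mem_union_left _ h)) (hloop a)
      noCut := hcut
      min := fun F'' hl hc hn => hmin F'' (Finset.mem_filter.2
        ⟨Finset.mem_univ _, hl, hc.trans hcard, hn⟩) }
  refine ⟨F', hloop, hcard, hcut.diKConnected hV, fun v => ⟨?_, ?_⟩⟩
  · exact natCast_le_max_of_sq_le (hopt.outdegF_bound hV hEout hEin)
  · refine natCast_le_max_of_sq_le ?_
    rw [← outdegF_rev]
    exact hopt.rev.outdegF_bound hV (fun u => by rw [outdegF_rev]; exact hEin u)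
      (fun u => by rw [indegF_rev]; exact hEout u)
end
end

section
/- Let f be an integer-valued biset function on a finite set V that is crossing supermodular and symmetric. Then the biset family F = {Ŝ : f(Ŝ) > 0} is weakly posi-uncrossable; that is, for any X̂, Ŷ ∈ F with X∖Y⁺ ≠ ∅ and Y∖X⁺ ≠ ∅, at least one of the bisets X̂∖Ŷ, Ŷ∖X̂ belongs to F. -/
noncomputable section

attribute [local instance] Classical.propDecidable

/-- `f` is crossing supermodular: the supermodular inequality holds whenever the
inner parts intersect and the outer parts do not cover `V`. -/
def CrossingSupermodular {V : Type*} [Fintype V] [DecidableEq V] (f : Biset V → ℤ) : Prop :=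
  ∀ A B : Biset V, (A.inner ∩ B.inner).Nonempty → A.outer ∪ B.outer ≠ Finset.univ →
    f A + f B ≤ f (Biset.inter A B) + f (Biset.union A B)

/-- The complement biset `(V∖S⁺, V∖S)` of `(S, S⁺)`. -/
def complBiset {V : Type*} [Fintype V] [DecidableEq V] (A : Biset V) : Biset V :=
  ⟨A.outerᶜ, A.innerᶜ, Finset.compl_subset_compl.mpr A.subset⟩

/-- `f` is symmetric: `f((S,S⁺)) = f((V∖S⁺, V∖S))`. -/
def SymmetricBisetFn {V : Type*} [Fintype V] [DecidableEq V] (f : Biset V → ℤ) : Prop :=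
  ∀ A : Biset V, f A = f (complBiset A)

/-- Intersecting with the complement biset is taking the difference. -/
theorem Biset.inter_complBiset {V : Type*} [Fintype V] [DecidableEq V] (A B : Biset V) :
    Biset.inter A (complBiset B) = Biset.diff A B := by
  simp only [Biset.inter, complBiset, Biset.diff, Biset.mk.injEq]
  constructor <;> ext v <;> simp

/-- The complement of `Â ∪ B̂ᶜ` is `B̂ ∖ Â`. -/
theorem complBiset_union_complBiset {V : Type*} [Fintype V] [DecidableEq V] (A B : Biset V) :
    complBiset (Biset.union A (complBiset B)) = Biset.diff B A := by
  simp only [Biset.union, complBiset, Biset.diff, Biset.mk.injEq]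
  constructor <;> ext v <;> simp [and_comm]

/-- A symmetric crossing supermodular biset function satisfies the difference inequality
on bisets whose inner parts are not contained in each other's outer parts. -/
theorem CrossingSupermodular.add_le_diff_add_diff {V : Type*} [Fintype V] [DecidableEq V]
    {f : Biset V → ℤ} (hcs : CrossingSupermodular f) (hsym : SymmetricBisetFn f)
    {A B : Biset V} (hAB : (A.inner \ B.outer).Nonempty) (hBA : (B.inner \ A.outer).Nonempty) :
    f A + f B ≤ f (Biset.diff A B) + f (Biset.diff B A) := by
  have key := hcs A (complBiset B)
    (by
      obtain ⟨v, hv⟩ := hAB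
      exact ⟨v, by simpa [complBiset] using hv⟩)
    (by
      obtain ⟨v, hv⟩ := hBA
      intro h
      have hmem := Finset.ext_iff.mp h v
      simp only [Finset.mem_sdiff] at hv
      simp [complBiset, hv.1, hv.2] at hmem)
  rwa [← hsym B, Biset.inter_complBiset, hsym (Biset.union A (complBiset B)),
    complBiset_union_complBiset] at key

theorem stmt_17 {V : Type*} [Fintype V] [DecidableEq V] (f : Biset V → ℤ)
    (hcs : CrossingSupermodular f) (hsym : SymmetricBisetFn f) :
    ∀ A B : Biset V, 0 < f A → 0 < f B →
      (A.inner \ B.outer).Nonempty → (B.inner \ A.outer).Nonempty →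
      0 < f (Biset.diff A B) ∨ 0 < f (Biset.diff B A) := by
  intro A B hA hB hAB hBA
  have key := hcs.add_le_diff_add_diff hsym hAB hBA
  omega
end
end

section
/- Let k ≥ 2 and p ≥ 1 be integers, let J' be a finite undirected graph on node set V' that is k-outconnected from a node s ∈ V' with exactly k edges incident to s, and let J = J' − s, the graph on V = V'∖{s} obtained by deleting s and its incident edges. For a graph H on node set W, let 𝒮_H denote the family of bisets Ŝ on W with S ≠ ∅, S⁺ ≠ W, and |δ_H(Ŝ)| < k − |Γ(Ŝ)|. Let U' = ⋃{S : Ŝ ∈ 𝒮_{J'}, |S| ≤ p} and U = ⋃{S : Ŝ ∈ 𝒮_J, |S| ≤ p}. Then |U'| ≤ p·k·(k − 1.5) and |U| ≤ 2p·k·(k − 0.5). -/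
noncomputable section

attribute [local instance] Classical.propDecidable

section OutConn

variable {V : Type*} [Fintype V] [DecidableEq V]

/-- `δ_H(Ŝ)` relative to ground node set `W`: edges of `H` with one end-node in the
inner part and the other in `W ∖ S⁺`. -/
def sDeltaW (W : Finset V) (H : Finset (Sym2 V)) (A : Biset V) : Finset (Sym2 V) :=
  H.filter fun e => ∃ a b : V, e = s(a, b) ∧ a ∈ A.inner ∧ b ∈ W ∧ b ∉ A.outer

/-- `H` is `k`-outconnected from `s` (ground set all of `V`). -/
def OutConnected (k : ℕ) (s : V) (H : Finset (Sym2 V)) : Prop :=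
  ∀ A : Biset V, A.inner.Nonempty → s ∉ A.outer →
    (k : ℤ) - ((Biset.boundary A).card : ℤ) ≤ ((sDeltaW Finset.univ H A).card : ℤ)

/-- The family `𝒮_H` of deficient bisets on ground set `W`: bisets with
`S⁺ ⊆ W`, `S ≠ ∅`, `S⁺ ≠ W`, and `|δ_H(Ŝ)| < k − |Γ(Ŝ)|`. -/
def deficientW (k : ℕ) (W : Finset V) (H : Finset (Sym2 V)) : Finset (Biset V) :=
  Finset.univ.filter fun A : Biset V =>
    A.outer ⊆ W ∧ A.inner.Nonempty ∧ A.outer ≠ W ∧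
      ((sDeltaW W H A).card : ℤ) < (k : ℤ) - ((Biset.boundary A).card : ℤ)

end OutConn

section Helpers

variable {V : Type*} [DecidableEq V]

/-- A set in which any two elements are joined by an arc of a digraph whose out-degrees
(not counting loops) are at most `d` has at most `2 * d + 1` elements. -/
theorem card_le_of_semicomplete (T : Finset V) (O : V → Finset V) (d : ℕ)
    (hT : ∀ v ∈ T, ∀ w ∈ T, w ∈ O v ∨ v ∈ O w)
    (hd : ∀ v ∈ T, (O v ∩ T).card ≤ d + 1) : T.card ≤ 2 * d + 1 := by
  have hself : ∀ v ∈ T, v ∈ O v := fun v hv => (hT v hv v hv).elim id id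
  have hdeg : ∀ v ∈ T, T.card + 1 ≤
      (T.filter fun w => w ∈ O v).card + (T.filter fun w => v ∈ O w).card := by
    intro v hv
    rw [← Finset.card_union_add_card_inter]
    apply Nat.add_le_add
    · apply Finset.card_le_card
      intro w hw
      simp only [Finset.mem_union, Finset.mem_filter]
      exact (hT v hv w hw).imp (fun h => ⟨hw, h⟩) (fun h => ⟨hw, h⟩)
    · apply Finset.card_pos.mpr
      exact ⟨v, by simp [hv, hself v hv]⟩
  have hsum := Finset.sum_le_sum hdeg
  have hswap : ∑ v ∈ T, (T.filter fun w => v ∈ O w).card =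
      ∑ v ∈ T, (T.filter fun w => w ∈ O v).card :=
    (Finset.sum_card_bipartiteAbove_eq_sum_card_bipartiteBelow (s := T) (t := T)
      (fun v w => v ∈ O w))
  have hout : ∑ v ∈ T, (T.filter fun w => w ∈ O v).card ≤ T.card * (d + 1) := by
    rw [← smul_eq_mul]
    apply Finset.sum_le_card_nsmul
    intro v hv
    refine le_trans (Finset.card_le_card ?_) (hd v hv)
    intro w hw
    simp only [Finset.mem_filter] at hw
    simp [hw.1, hw.2]
  rw [Finset.sum_add_distrib (f := fun v => (T.filter fun w => w ∈ O v).card), hswap,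
    Finset.sum_const, smul_eq_mul] at hsum
  by_contra! hlt
  have h1 : T.card * (2 * (d + 1)) < T.card * (T.card + 1) :=
    Nat.mul_lt_mul_of_pos_left (by omega) (by omega)
  nlinarith

theorem Biset.card_inner_add_card_boundary (A : Biset V) :
    A.inner.card + A.boundary.card = A.outer.card := by
  have := Finset.card_sdiff_add_card_eq_card A.subset
  unfold Biset.boundary
  omega

theorem Biset.card_boundary_diff_add (A B : Biset V) :
    (A.diff B).boundary.card + (B.diff A).boundary.card =
      A.boundary.card + B.boundary.card := by
  rw [← Finset.card_union_add_card_inter, ← Finset.card_union_add_card_inter A.boundary]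
  have hA := A.subset
  have hB := B.subset
  congr 2 <;> ext x <;> have hAx := @hA x <;> have hBx := @hB x <;>
    simp only [Biset.boundary, Biset.diff, Finset.mem_union, Finset.mem_inter,
      Finset.mem_sdiff] <;> tauto

variable [Fintype V]

theorem mem_sDeltaW {W : Finset V} {H : Finset (Sym2 V)} {A : Biset V} {e : Sym2 V} :
    e ∈ sDeltaW W H A ↔
      e ∈ H ∧ ∃ a b : V, e = s(a, b) ∧ a ∈ A.inner ∧ b ∈ W ∧ b ∉ A.outer := by
  simp [sDeltaW]

theorem mem_deficientW {k : ℕ} {W : Finset V} {H : Finset (Sym2 V)} {A : Biset V} :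
    A ∈ deficientW k W H ↔ A.outer ⊆ W ∧ A.inner.Nonempty ∧ A.outer ≠ W ∧
      (sDeltaW W H A).card + A.boundary.card < k := by
  simp only [deficientW, Finset.mem_filter, Finset.mem_univ, true_and]
  constructor <;> rintro ⟨h1, h2, h3, h4⟩ <;> exact ⟨h1, h2, h3, by omega⟩

theorem card_sDeltaW_diff_add_le (W : Finset V) (H : Finset (Sym2 V)) (A B : Biset V)
    (hA : A.outer ⊆ W) (hB : B.outer ⊆ W) :
    (sDeltaW W H (A.diff B)).card + (sDeltaW W H (B.diff A)).card ≤
      (sDeltaW W H A).card + (sDeltaW W H B).card := by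
  have hsub : ∀ A B : Biset V, A.outer ⊆ W →
      sDeltaW W H (A.diff B) ⊆ sDeltaW W H A ∪ sDeltaW W H B := by
    intro A B hA e he
    rw [mem_sDeltaW] at he
    obtain ⟨heH, a, b, rfl, ha, hbW, hb⟩ := he
    simp only [Biset.diff, Finset.mem_sdiff, not_and, not_not] at ha hb
    rw [Finset.mem_union, mem_sDeltaW, mem_sDeltaW]
    by_cases hbA : b ∈ A.outer
    · exact Or.inr ⟨heH, b, a, Sym2.eq_swap, hb hbA, hA (A.subset ha.1), ha.2⟩
    · exact Or.inl ⟨heH, a, b, rfl, ha.1, hbW, hbA⟩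
  rw [← Finset.card_union_add_card_inter, ← Finset.card_union_add_card_inter (sDeltaW W H A)]
  apply Nat.add_le_add <;> apply Finset.card_le_card
  · apply Finset.union_subset (hsub A B hA)
    rw [Finset.union_comm]
    exact hsub B A hB
  · intro e he
    rw [Finset.mem_inter, mem_sDeltaW, mem_sDeltaW] at he
    obtain ⟨⟨heH, a, b, rfl, ha, hbW, hb⟩, -, c, d, hcd, hc, -, -⟩ := he
    simp only [Biset.diff, Finset.mem_sdiff] at ha hc
    rw [Sym2.eq_iff] at hcd
    rcases hcd with ⟨rfl, rfl⟩ | ⟨rfl, rfl⟩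
    · exact absurd (A.subset ha.1) hc.2
    · rw [Finset.mem_inter, mem_sDeltaW, mem_sDeltaW]
      exact ⟨⟨heH, a, b, rfl, ha.1, hbW, hc.2⟩,
        ⟨heH, b, a, Sym2.eq_swap, hc.1, hA (A.subset ha.1), ha.2⟩⟩

/-- Uncrossing: if neither outer part swallows the other inner part, then one of the two
differences of deficient bisets is deficient. -/
theorem diff_mem_deficientW {k : ℕ} {W : Finset V} {H : Finset (Sym2 V)} {A B : Biset V}
    (hA : A ∈ deficientW k W H) (hB : B ∈ deficientW k W H) {v w : V}
    (hv : v ∈ A.inner) (hvB : v ∉ B.outer) (hw : w ∈ B.inner) (hwA : w ∉ A.outer) :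
    A.diff B ∈ deficientW k W H ∨ B.diff A ∈ deficientW k W H := by
  rw [mem_deficientW] at hA hB
  have h1 := A.card_boundary_diff_add B
  have h2 := card_sDeltaW_diff_add_le W H A B hA.1 hB.1
  have hmem : ∀ A B : Biset V, A.outer ⊆ W → B.outer ⊆ W → ∀ v w : V, v ∈ A.inner →
      v ∉ B.outer → w ∈ B.inner →
      (sDeltaW W H (A.diff B)).card + (A.diff B).boundary.card < k →
      A.diff B ∈ deficientW k W H := by
    intro A B hA hB v w hv hvB hw hlt
    rw [mem_deficientW]
    refine ⟨Finset.sdiff_subset.trans hA, ⟨v, Finset.mem_sdiff.mpr ⟨hv, hvB⟩⟩, ?_, hlt⟩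
    intro heq
    have hwW : w ∈ (A.diff B).outer := heq ▸ hB (B.subset hw)
    exact (Finset.mem_sdiff.mp hwW).2 hw
  by_cases hlt : (sDeltaW W H (A.diff B)).card + (A.diff B).boundary.card < k
  · exact Or.inl (hmem A B hA.1 hB.1 v w hv hvB hw hlt)
  · exact Or.inr (hmem B A hB.1 hA.1 w v hw hwA hv (by omega))

/-- If every deficient biset has at least `c` elements of `R` in its inner part, then the union
`U` of the small ones is bounded in terms of how many elements of `U` the outer parts have. -/
theorem mul_card_sup_inner_le {k p c d : ℕ} {W : Finset V} {H : Finset (Sym2 V)}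
    {R U : Finset V}
    (hU : ∀ v ∈ U, ∃ A ∈ deficientW k W H, A.inner.card ≤ p ∧ v ∈ A.inner)
    (hc : ∀ A ∈ deficientW k W H, c ≤ (R ∩ A.inner).card)
    (hd : ∀ A ∈ deficientW k W H, A.inner.card ≤ p → (A.outer ∩ U).card ≤ d + 1) :
    c * U.card ≤ R.card * (2 * d + 1) := by
  have hmin : ∀ v : V, ∃ A : Biset V, v ∈ U → A ∈ deficientW k W H ∧ v ∈ A.inner ∧
      A.inner.card ≤ p ∧ ∀ B ∈ deficientW k W H, v ∈ B.inner → A.inner.card ≤ B.inner.card := by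
    intro v
    by_cases hv : v ∈ U
    · obtain ⟨A₀, hA₀, hp, hvA₀⟩ := hU v hv
      obtain ⟨A, hA, hle⟩ := Finset.exists_min_image
        ((deficientW k W H).filter fun A => v ∈ A.inner) (fun A => A.inner.card)
        ⟨A₀, by simp [hA₀, hvA₀]⟩
      simp only [Finset.mem_filter, and_imp] at hA hle
      exact ⟨A, fun _ => ⟨hA.1, hA.2, (hle A₀ hA₀ hvA₀).trans hp, hle⟩⟩
    · exact ⟨⟨∅, ∅, subset_rfl⟩, fun h => absurd h hv⟩
  choose S hS using hmin
  have hshrink : ∀ A B : Biset V, ∀ r, r ∈ A.inner → r ∈ B.inner →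
      (A.diff B).inner.card < A.inner.card := by
    intro A B r hrA hrB
    apply Finset.card_lt_card
    refine (Finset.ssubset_iff_of_subset Finset.sdiff_subset).mpr ?_
    exact ⟨r, hrA, fun h => (Finset.mem_sdiff.mp h).2 (B.subset hrB)⟩
  have hdeg : ∀ r ∈ R, (U.filter fun v => r ∈ (S v).inner).card ≤ 2 * d + 1 := by
    intro r _
    apply card_le_of_semicomplete _ (fun v => (S v).outer)
    · intro v hv w hw
      simp only [Finset.mem_filter] at hv hw
      obtain ⟨hSv, hvS, -, hvmin⟩ := hS v hv.1
      obtain ⟨hSw, hwS, -, hwmin⟩ := hS w hw.1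
      by_contra! hcon
      rcases diff_mem_deficientW hSv hSw hvS hcon.2 hwS hcon.1 with h | h
      · have := hvmin _ h (Finset.mem_sdiff.mpr ⟨hvS, hcon.2⟩)
        have := hshrink (S v) (S w) r hv.2 hw.2
        omega
      · have := hwmin _ h (Finset.mem_sdiff.mpr ⟨hwS, hcon.1⟩)
        have := hshrink (S w) (S v) r hw.2 hv.2
        omega
    · intro v hv
      have hv := (Finset.mem_filter.mp hv).1
      obtain ⟨hSv, -, hp, -⟩ := hS v hv
      refine le_trans (Finset.card_le_card ?_) (hd _ hSv hp)
      exact Finset.inter_subset_inter subset_rfl (Finset.filter_subset _ _)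
  calc c * U.card = ∑ v ∈ U, c := by simp [mul_comm]
    _ ≤ ∑ v ∈ U, (R.filter fun r => r ∈ (S v).inner).card := by
        apply Finset.sum_le_sum
        intro v hv
        rw [Finset.filter_mem_eq_inter]
        exact hc _ (hS v hv).1
    _ = ∑ r ∈ R, (U.filter fun v => r ∈ (S v).inner).card :=
        Finset.sum_card_bipartiteAbove_eq_sum_card_bipartiteBelow
          (fun v r => r ∈ (S v).inner)
    _ ≤ R.card * (2 * d + 1) := by
        rw [← smul_eq_mul]
        exact Finset.sum_le_card_nsmul _ _ _ hdeg

/-- The biset `(V ∖ S⁺, V ∖ S)`. -/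
def Biset.co (A : Biset V) : Biset V :=
  ⟨A.outerᶜ, A.innerᶜ, Finset.compl_subset_compl.mpr A.subset⟩

theorem Biset.co_mem_deficientW {k : ℕ} {H : Finset (Sym2 V)} {A : Biset V}
    (hA : A ∈ deficientW k Finset.univ H) : A.co ∈ deficientW k Finset.univ H := by
  rw [mem_deficientW] at hA ⊢
  obtain ⟨-, ⟨v, hv⟩, hne, hlt⟩ := hA
  refine ⟨Finset.subset_univ _, ?_, ?_, lt_of_le_of_lt (Nat.add_le_add ?_ ?_) hlt⟩
  · obtain ⟨w, hw⟩ := not_forall.mp (mt Finset.eq_univ_iff_forall.mpr hne)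
    exact ⟨w, by simpa [Biset.co] using hw⟩
  · intro h
    have : v ∈ A.co.outer := h ▸ Finset.mem_univ v
    simp [Biset.co, hv] at this
  · apply Finset.card_le_card
    intro e he
    rw [mem_sDeltaW] at he ⊢
    obtain ⟨heH, a, b, rfl, ha, -, hb⟩ := he
    simp only [Biset.co, Finset.mem_compl, not_not] at ha hb
    exact ⟨heH, b, a, Sym2.eq_swap, hb, Finset.mem_univ _, ha⟩
  · apply Finset.card_le_card
    intro x
    simp only [Biset.boundary, Biset.co, Finset.mem_sdiff, Finset.mem_compl]
    tauto

/-- The nodes adjacent to `s`. -/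
def nbrs (H : Finset (Sym2 V)) (s : V) : Finset V :=
  Finset.univ.filter fun r => s(s, r) ∈ H

theorem card_nbrs_le (H : Finset (Sym2 V)) (s : V) :
    (nbrs H s).card ≤ (H.filter fun e => s ∈ e).card := by
  apply Finset.card_le_card_of_injOn (fun r => s(s, r))
  · intro r hr
    simpa [nbrs] using hr
  · intro a _ b _ h
    exact Sym2.congr_right.mp h

/-- Removing `s` from the outer part of a biset (and enlarging the ground set by `s`) adds only
edges between `s` and the inner part. -/
theorem card_sDeltaW_erase_le {H H' : Finset (Sym2 V)} {W : Finset V} {s : V} {A B : Biset V}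
    (hinner : B.inner = A.inner) (hs : s ∉ A.inner)
    (hH : ∀ e ∈ H', s ∉ e → e ∈ H) (hW : ∀ v, v ≠ s → v ∈ W)
    (houter : ∀ v, v ≠ s → v ∈ A.outer → v ∈ B.outer) :
    (sDeltaW Finset.univ H' B).card ≤
      (sDeltaW W H A).card + (nbrs H' s ∩ A.inner).card := by
  have hsub : sDeltaW Finset.univ H' B ⊆
      sDeltaW W H A ∪ (nbrs H' s ∩ A.inner).image fun r => s(s, r) := by
    intro e he
    rw [mem_sDeltaW] at he
    obtain ⟨heH, a, b, rfl, ha, -, hb⟩ := he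
    rw [hinner] at ha
    have has : a ≠ s := fun h => hs (h ▸ ha)
    rw [Finset.mem_union, mem_sDeltaW, Finset.mem_image]
    by_cases hbs : b = s
    · subst hbs
      refine Or.inr ⟨a, ?_, Sym2.eq_swap⟩
      simp only [nbrs, Finset.mem_inter, Finset.mem_filter, Finset.mem_univ, true_and]
      exact ⟨Sym2.eq_swap (a := a) (b := b) ▸ heH, ha⟩
    · refine Or.inl ⟨hH _ heH ?_, a, b, rfl, ha, hW b hbs, fun h => hb (houter b hbs h)⟩
      rw [Sym2.mem_iff]
      rintro (h | h)
      · exact has h.symm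
      · exact hbs h.symm
  calc _ ≤ _ := Finset.card_le_card hsub
    _ ≤ _ := Finset.card_union_le _ _
    _ ≤ _ := Nat.add_le_add_left Finset.card_image_le _

theorem OutConnected.root_mem_outer {k : ℕ} {s : V} {H : Finset (Sym2 V)} {A : Biset V}
    (hout : OutConnected k s H) (hA : A ∈ deficientW k Finset.univ H) : s ∈ A.outer := by
  by_contra hs
  rw [mem_deficientW] at hA
  have := hout A hA.2.1 hs
  omega

theorem OutConnected.root_notMem_inner {k : ℕ} {s : V} {H : Finset (Sym2 V)} {A : Biset V}
    (hout : OutConnected k s H) (hA : A ∈ deficientW k Finset.univ H) : s ∉ A.inner := by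
  simpa [Biset.co] using hout.root_mem_outer (Biset.co_mem_deficientW hA)

theorem OutConnected.two_le_card_nbrs_inter {k : ℕ} {s : V} {H : Finset (Sym2 V)} {A : Biset V}
    (hout : OutConnected k s H) (hA : A ∈ deficientW k Finset.univ H) :
    2 ≤ (nbrs H s ∩ A.inner).card := by
  have hso := hout.root_mem_outer hA
  have hsi := hout.root_notMem_inner hA
  rw [mem_deficientW] at hA
  let B : Biset V := ⟨A.inner, A.outer.erase s, fun v hv =>
    Finset.mem_erase.mpr ⟨fun h => hsi (h ▸ hv), A.subset hv⟩⟩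
  have h1 := hout B hA.2.1 (Finset.notMem_erase s A.outer)
  have h2 := card_sDeltaW_erase_le (H := H) (H' := H) (W := Finset.univ) (A := A) (B := B)
    rfl hsi (fun e he _ => he) (fun v _ => Finset.mem_univ v)
    (fun v hv hvA => Finset.mem_erase.mpr ⟨hv, hvA⟩)
  have h3 : A.inner.card + B.boundary.card + 1 = A.outer.card := by
    rw [show A.inner.card = B.inner.card from rfl, B.card_inner_add_card_boundary]
    exact Finset.card_erase_add_one hso
  have h4 := A.card_inner_add_card_boundary
  omega

theorem OutConnected.one_le_card_nbrs_inter {k : ℕ} {s : V} {H : Finset (Sym2 V)} {A : Biset V}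
    (hout : OutConnected k s H)
    (hA : A ∈ deficientW k (Finset.univ.erase s) (H.filter fun e => s ∉ e)) :
    1 ≤ (nbrs H s ∩ A.inner).card := by
  rw [mem_deficientW] at hA
  have hso : s ∉ A.outer := fun h => by simpa using hA.1 h
  have h1 := hout A hA.2.1 hso
  have h2 := card_sDeltaW_erase_le (H := H.filter fun e => s ∉ e) (H' := H)
    (W := Finset.univ.erase s) (s := s) (A := A) (B := A)
    rfl (fun h => hso (A.subset h)) (fun e he hse => by simp [he, hse])
    (fun v hv => by simp [hv]) (fun v _ hvA => hvA)
  omega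

theorem OutConnected.four_le {k : ℕ} {s : V} {H : Finset (Sym2 V)} {A : Biset V}
    (hout : OutConnected k s H) (hdeg : (nbrs H s).card ≤ k)
    (hA : A ∈ deficientW k Finset.univ H) : 4 ≤ k := by
  have h1 := hout.two_le_card_nbrs_inter hA
  have h2 := hout.two_le_card_nbrs_inter (Biset.co_mem_deficientW hA)
  have hdisj : Disjoint (nbrs H s ∩ A.inner) (nbrs H s ∩ A.co.inner) := by
    rw [Finset.disjoint_left]
    intro x hx hx'
    exact Finset.mem_compl.mp (Finset.mem_inter.mp hx').2 (A.subset (Finset.mem_inter.mp hx).2)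
  have h3 := Finset.card_union_of_disjoint hdisj
  have h4 : (nbrs H s ∩ A.inner ∪ nbrs H s ∩ A.co.inner).card ≤ (nbrs H s).card :=
    Finset.card_le_card (Finset.union_subset Finset.inter_subset_left Finset.inter_subset_left)
  omega

end Helpers

theorem stmt_19 {V' : Type*} [Fintype V'] [DecidableEq V']
    (k p : ℕ) (hk : 2 ≤ k) (hp : 1 ≤ p)
    (J' : Finset (Sym2 V')) (s : V')
    (hout : OutConnected k s J')
    (hsdeg : (J'.filter fun e => s ∈ e).card = k)
    (J : Finset (Sym2 V')) (hJ : J = J'.filter fun e => s ∉ e)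
    (U' U : Finset V')
    (hU' : U' = ((deficientW k Finset.univ J').filter fun A => A.inner.card ≤ p).sup
      Biset.inner)
    (hU : U = ((deficientW k (Finset.univ.erase s) J).filter fun A => A.inner.card ≤ p).sup
      Biset.inner) :
    (U'.card : ℝ) ≤ (p : ℝ) * (k : ℝ) * ((k : ℝ) - 1.5) ∧
    (U.card : ℝ) ≤ 2 * (p : ℝ) * (k : ℝ) * ((k : ℝ) - 0.5) := by
  have hR : (nbrs J' s).card ≤ k := hsdeg ▸ card_nbrs_le J' s
  have hmemU' : ∀ v ∈ U', ∃ A ∈ deficientW k Finset.univ J', A.inner.card ≤ p ∧ v ∈ A.inner := by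
    intro v hv
    rw [hU', Finset.mem_sup] at hv
    obtain ⟨A, hA, hvA⟩ := hv
    rw [Finset.mem_filter] at hA
    exact ⟨A, hA.1, hA.2, hvA⟩
  have hmemU : ∀ v ∈ U, ∃ A ∈ deficientW k (Finset.univ.erase s) J,
      A.inner.card ≤ p ∧ v ∈ A.inner := by
    intro v hv
    rw [hU, Finset.mem_sup] at hv
    obtain ⟨A, hA, hvA⟩ := hv
    rw [Finset.mem_filter] at hA
    exact ⟨A, hA.1, hA.2, hvA⟩
  have hkR : (2 : ℝ) ≤ k := by exact_mod_cast hk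
  have hpR : (1 : ℝ) ≤ p := by exact_mod_cast hp
  constructor
  · rcases U'.eq_empty_or_nonempty with hemp | ⟨v, hv⟩
    · rw [hemp, Finset.card_empty, Nat.cast_zero]
      exact mul_nonneg (by positivity) (by linarith)
    obtain ⟨A, hA, -, -⟩ := hmemU' v hv
    have hk4 := hout.four_le hR hA
    obtain ⟨m, rfl⟩ : ∃ m, k = m + 3 := ⟨k - 3, by omega⟩
    have hbound := mul_card_sup_inner_le (d := p + m) hmemU'
      (fun A hA => hout.two_le_card_nbrs_inter hA) (by
        intro A hA hAp
        have hsub : A.outer ∩ U' ⊆ A.outer.erase s := by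
          intro x hx
          rw [Finset.mem_inter] at hx
          refine Finset.mem_erase.mpr ⟨?_, hx.1⟩
          rintro rfl
          obtain ⟨B, hB, -, hxB⟩ := hmemU' x hx.2
          exact hout.root_notMem_inner hB hxB
        have h1 := Finset.card_le_card hsub
        have h2 := Finset.card_erase_add_one (hout.root_mem_outer hA)
        have h3 := A.card_inner_add_card_boundary
        rw [mem_deficientW] at hA
        omega)
    have hle := hbound.trans (Nat.mul_le_mul_right _ hR)
    have hleR : (2 : ℝ) * U'.card ≤ (m + 3) * (2 * (p + m) + 1) := by exact_mod_cast hle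
    have hm : (0 : ℝ) ≤ m := Nat.cast_nonneg m
    push_cast
    have hfac : (0 : ℝ) ≤ (m + 3) * ((p - 1) * (2 * m + 1)) :=
      mul_nonneg (by linarith) (mul_nonneg (by linarith) (by linarith))
    nlinarith
  · obtain ⟨m, rfl⟩ : ∃ m, k = m + 2 := ⟨k - 2, by omega⟩
    have hbound := mul_card_sup_inner_le (d := p + m) (R := nbrs J' s) (c := 1) hmemU
      (fun A hA => hout.one_le_card_nbrs_inter (hJ ▸ hA)) (by
        intro A hA hAp
        have h1 : (A.outer ∩ U).card ≤ A.outer.card := Finset.card_le_card Finset.inter_subset_left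
        have h3 := A.card_inner_add_card_boundary
        rw [mem_deficientW] at hA
        omega)
    have hle := hbound.trans (Nat.mul_le_mul_right _ hR)
    have hleR : (1 : ℝ) * U.card ≤ (m + 2) * (2 * (p + m) + 1) := by exact_mod_cast hle
    have hm : (0 : ℝ) ≤ m := Nat.cast_nonneg m
    push_cast
    have hfac : (0 : ℝ) ≤ (m + 2) * ((p - 1) * (2 * m + 1)) :=
      mul_nonneg (by linarith) (mul_nonneg (by linarith) (by linarith))
    nlinarith
end
end
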